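/- arXiv:1508.01977 — 4 statements merged into one kernel-verified Lean document; each statement's English description precedes it below -/
import Mathlib

section
/- Let ε ∈ (0, 1/2] and suppose r ≤ (ε/100)·(log(50/ε))^(−3/2). Then for every x in the interior of K, the Metropolis filter changes the Gaussian step distribution by at most ε: 1 − E_{z ∼ gₓ}[ 1_{int(K)}(z) · min{1, g_z(x)/gₓ(z)} ] ≤ ε; equivalently, the total variation distance between the one-step distribution μₓ of the Gaussian Dikin walk and the Gaussian distribution gₓ is at most ε. -/
open Matrix MeasureTheory ProbabilityTheory Real

/-- Interior of the polytope K = {x : aᵢᵀx ≥ bᵢ}. -/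
def intK {n m : ℕ} (a : Fin m → Fin n → ℝ) (b : Fin m → ℝ) : Set (Fin n → ℝ) :=
  {x | ∀ i, b i < a i ⬝ᵥ x}

/-- Hessian of the log-barrier: H(x) = ∑ᵢ aᵢaᵢᵀ/(aᵢᵀx − bᵢ)². -/
noncomputable def Hmat {n m : ℕ} (a : Fin m → Fin n → ℝ) (b : Fin m → ℝ)
    (x : Fin n → ℝ) : Matrix (Fin n) (Fin n) ℝ :=
  ∑ i, ((a i ⬝ᵥ x - b i) ^ 2)⁻¹ • vecMulVec (a i) (a i)

/-- Density of the Gaussian N(x, (r²/n) H(x)⁻¹):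
`gₓ(z) = √(det H(x)) (n/(2πr²))^(n/2) exp(−(n/(2r²))‖z−x‖ₓ²)`. -/
noncomputable def gDen {n m : ℕ} (r : ℝ) (a : Fin m → Fin n → ℝ) (b : Fin m → ℝ)
    (x z : Fin n → ℝ) : ℝ :=
  Real.sqrt (Hmat a b x).det * ((n : ℝ) / (2 * π * r ^ 2)) ^ ((n : ℝ) / 2) *
    Real.exp (-((n : ℝ) / (2 * r ^ 2)) * ((z - x) ⬝ᵥ (Hmat a b x).mulVec (z - x)))

/-- The Gaussian measure gₓ = N(x, (r²/n) H(x)⁻¹), given by its density w.r.t. Lebesgue. -/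
noncomputable def gaussMeas {n m : ℕ} (r : ℝ) (a : Fin m → Fin n → ℝ) (b : Fin m → ℝ)
    (x : Fin n → ℝ) : Measure (Fin n → ℝ) :=
  volume.withDensity fun z => ENNReal.ofReal (gDen r a b x z)

open scoped MatrixOrder in
lemma Matrix.PosDef.exists_det_ne_zero_eq_transpose_mul_self {n : ℕ}
    {H : Matrix (Fin n) (Fin n) ℝ} (hH : H.PosDef) :
    ∃ R : Matrix (Fin n) (Fin n) ℝ, R.det ≠ 0 ∧ H = Rᵀ * R := by
  obtain ⟨R, rfl⟩ := CStarAlgebra.nonneg_iff_eq_star_mul_self.mp hH.posSemidef.nonneg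
  refine ⟨R, fun h => ?_, by simp [star_eq_conjTranspose]⟩
  have := hH.det_pos
  simp [h] at this

lemma integral_exp_neg_mul_quadForm {n : ℕ} {H : Matrix (Fin n) (Fin n) ℝ} (hH : H.PosDef)
    (β : ℝ) :
    ∫ z : Fin n → ℝ, Real.exp (-β * (z ⬝ᵥ H *ᵥ z)) = √(π / β) ^ n / √H.det := by
  obtain ⟨R, hR, rfl⟩ := hH.exists_det_ne_zero_eq_transpose_mul_self
  have h1 : ∀ z : Fin n → ℝ, Real.exp (-β * (z ⬝ᵥ (Rᵀ * R) *ᵥ z))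
      = (fun y : Fin n → ℝ => ∏ i, Real.exp (-β * y i ^ 2)) (toLin' R z) := by
    intro z
    simp only [toLin'_apply]
    rw [← Real.exp_sum, ← Finset.mul_sum, ← mulVec_mulVec, dotProduct_mulVec, vecMul_transpose]
    simp [dotProduct, sq]
  have hmeas : Measurable (toLin' R) := by
    exact (LinearMap.continuous_of_finiteDimensional (toLin' R)).measurable
  have hcont : Continuous (fun y : Fin n → ℝ => ∏ i, Real.exp (-β * y i ^ 2)) := by fun_prop
  calc _ = ∫ y, (fun y : Fin n → ℝ => ∏ i, Real.exp (-β * y i ^ 2)) y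
            ∂(Measure.map (toLin' R) volume) := by
        rw [integral_map hmeas.aemeasurable hcont.aestronglyMeasurable]
        exact integral_congr_ae (ae_of_all _ h1)
    _ = _ := by
        rw [Real.map_matrix_volume_pi_eq_smul_volume_pi hR, integral_smul_measure,
          integral_fintype_prod_volume_eq_pow (fun y : ℝ => Real.exp (-β * y ^ 2)),
          integral_gaussian, ENNReal.toReal_ofReal (abs_nonneg _), det_mul, det_transpose,
          Real.sqrt_mul_self_eq_abs, abs_inv, Fintype.card_fin, smul_eq_mul, inv_mul_eq_div]

section Moments

variable {Ω : Type*} [MeasurableSpace Ω] {μ : Measure Ω}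

lemma iteratedDeriv_exp_mul_sq (v : ℝ) :
    iteratedDeriv 2 (fun t : ℝ => Real.exp (v * t ^ 2 / 2)) 0 = v ∧
    iteratedDeriv 4 (fun t : ℝ => Real.exp (v * t ^ 2 / 2)) 0 = 3 * v ^ 2 ∧
    iteratedDeriv 6 (fun t : ℝ => Real.exp (v * t ^ 2 / 2)) 0 = 15 * v ^ 3 := by
  set E : ℝ → ℝ := fun t => Real.exp (v * t ^ 2 / 2) with hE
  have hE' : ∀ t, HasDerivAt E (v * t * E t) t := fun t => by
    have := (((hasDerivAt_pow 2 t).const_mul v).div_const 2).exp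
    convert! this using 1
    simp [hE]; ring
  have step : ∀ (k : ℕ) (f f' : ℝ → ℝ), iteratedDeriv k E = (fun t => f t * E t) →
      (∀ t, HasDerivAt f (f' t) t) →
      iteratedDeriv (k + 1) E = fun t => (f' t + f t * (v * t)) * E t := by
    intro k f f' h hf
    rw [iteratedDeriv_succ, h]
    ext t
    rw [((hf t).fun_mul (hE' t)).deriv]
    ring
  have hpow : ∀ (k : ℕ) (t : ℝ), HasDerivAt (fun t : ℝ => t ^ k) (k * t ^ (k - 1)) t :=
    fun k t => hasDerivAt_pow k t
  have d0 : iteratedDeriv 0 E = fun t => (1 : ℝ) * E t := by simp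
  have d1 := step 0 _ _ d0 (fun t => hasDerivAt_const t 1)
  have d1' : iteratedDeriv 1 E = fun t => (v * t) * E t := by simpa using d1
  have d2 := step 1 _ (fun _ => v) d1' (fun t => by simpa using (hasDerivAt_id t).const_mul v)
  have d2' : iteratedDeriv 2 E = fun t => (v + v ^ 2 * t ^ 2) * E t := by
    rw [d2]; ext t; ring
  have d3 := step 2 _ (fun t => v ^ 2 * (2 * t)) d2' (fun t => by
    simpa using ((hpow 2 t).const_mul (v ^ 2)).const_add v)
  have d3' : iteratedDeriv 3 E = fun t => (3 * v ^ 2 * t + v ^ 3 * t ^ 3) * E t := by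
    rw [d3]; ext t; ring
  have d4 := step 3 _ (fun t => 3 * v ^ 2 + v ^ 3 * (3 * t ^ 2)) d3' (fun t => by
    simpa using ((hasDerivAt_id t).const_mul (3 * v ^ 2)).fun_add ((hpow 3 t).const_mul (v ^ 3)))
  have d4' : iteratedDeriv 4 E = fun t =>
      (3 * v ^ 2 + 6 * v ^ 3 * t ^ 2 + v ^ 4 * t ^ 4) * E t := by
    rw [d4]; ext t; ring
  have d5 := step 4 _ (fun t => 6 * v ^ 3 * (2 * t) + v ^ 4 * (4 * t ^ 3)) d4' (fun t => by
    simpa using (((hpow 2 t).const_mul (6 * v ^ 3)).const_add (3 * v ^ 2)).fun_add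
      ((hpow 4 t).const_mul (v ^ 4)))
  have d5' : iteratedDeriv 5 E = fun t =>
      (15 * v ^ 3 * t + 10 * v ^ 4 * t ^ 3 + v ^ 5 * t ^ 5) * E t := by
    rw [d5]; ext t; ring
  have d6 := step 5 _ (fun t => 15 * v ^ 3 + 10 * v ^ 4 * (3 * t ^ 2) + v ^ 5 * (5 * t ^ 4)) d5'
    (fun t => by
      simpa using (((hasDerivAt_id t).const_mul (15 * v ^ 3)).fun_add
        ((hpow 3 t).const_mul (10 * v ^ 4))).fun_add ((hpow 5 t).const_mul (v ^ 5)))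
  rw [d2', d4', d6]
  simp [hE]

/-- `Y` has the moment generating function of a centered Gaussian variable of variance `v`. -/
def HasGaussianMGF (Y : Ω → ℝ) (μ : Measure Ω) (v : ℝ) : Prop :=
  ∀ t, mgf Y μ t = Real.exp (v * t ^ 2 / 2)

namespace HasGaussianMGF

variable {Y Z : Ω → ℝ} {v w p : ℝ}

lemma integrableExpSet_eq_univ (h : HasGaussianMGF Y μ v) : integrableExpSet Y μ = Set.univ := by
  refine Set.eq_univ_of_forall fun t => ?_
  by_contra hc
  have := mgf_undef (t := t) hc
  rw [h t] at this
  exact (Real.exp_pos _).ne' this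

lemma zero_mem (h : HasGaussianMGF Y μ v) : (0 : ℝ) ∈ interior (integrableExpSet Y μ) := by
  simp [h.integrableExpSet_eq_univ]

lemma integrable_pow (h : HasGaussianMGF Y μ v) (k : ℕ) : Integrable (fun z => Y z ^ k) μ :=
  integrable_pow_of_mem_interior_integrableExpSet h.zero_mem k

lemma integral_pow (h : HasGaussianMGF Y μ v) (k : ℕ) :
    ∫ z, Y z ^ k ∂μ = iteratedDeriv k (fun t : ℝ => Real.exp (v * t ^ 2 / 2)) 0 := by
  have := iteratedDeriv_mgf_zero h.zero_mem k
  rw [show mgf Y μ = fun t : ℝ => Real.exp (v * t ^ 2 / 2) from funext h] at this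
  rw [this]
  rfl

lemma integral_sq (h : HasGaussianMGF Y μ v) : ∫ z, Y z ^ 2 ∂μ = v :=
  (h.integral_pow 2).trans (iteratedDeriv_exp_mul_sq v).1

lemma integral_pow_four (h : HasGaussianMGF Y μ v) : ∫ z, Y z ^ 4 ∂μ = 3 * v ^ 2 :=
  (h.integral_pow 4).trans (iteratedDeriv_exp_mul_sq v).2.1

lemma integral_pow_six (h : HasGaussianMGF Y μ v) : ∫ z, Y z ^ 6 ∂μ = 15 * v ^ 3 :=
  (h.integral_pow 6).trans (iteratedDeriv_exp_mul_sq v).2.2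

/-- Polarization of the sixth moment of a centered Gaussian pair. -/
lemma integral_cube_mul_cube
    (h : ∀ s : ℝ, HasGaussianMGF (fun z => s * Y z + Z z) μ (s ^ 2 * v + 2 * s * p + w)) :
    Integrable (fun z => Y z ^ 3 * Z z ^ 3) μ ∧
      ∫ z, Y z ^ 3 * Z z ^ 3 ∂μ = 6 * p ^ 3 + 9 * v * w * p := by
  have I := fun s => (h s).integrable_pow 6
  have J := fun s => (h s).integral_pow_six
  let c : Fin 6 → ℝ := ![-13 / 960, 13 / 960, 1 / 120, -1 / 120, -1 / 960, 1 / 960]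
  let s : Fin 6 → ℝ := ![1, -1, 2, -2, 3, -3]
  have e : (fun z => Y z ^ 3 * Z z ^ 3) = fun z => ∑ k, c k * (s k * Y z + Z z) ^ 6 := by
    ext z
    simp [c, s, Fin.sum_univ_succ]
    ring
  have I' : ∀ k ∈ Finset.univ, Integrable (fun z => c k * (s k * Y z + Z z) ^ 6) μ :=
    fun k _ => (I (s k)).const_mul (c k)
  refine ⟨by rw [e]; exact integrable_finsetSum _ I', ?_⟩
  rw [e, integral_finsetSum _ I']
  simp only [integral_const_mul, J]
  simp [c, s, Fin.sum_univ_succ]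
  ring

end HasGaussianMGF

end Moments

lemma dotProduct_sq_sum_eigenvectorBasis {n : ℕ} {M : Matrix (Fin n) (Fin n) ℝ}
    (hM : M.IsHermitian) (v : Fin n → ℝ) :
    ∑ k, (v ⬝ᵥ (hM.eigenvectorBasis k).ofLp) ^ 2 = v ⬝ᵥ v := by
  have := hM.eigenvectorBasis.sum_sq_inner_left (WithLp.toLp 2 v)
  rw [EuclideanSpace.real_norm_sq_eq] at this
  simp only [EuclideanSpace.inner_eq_star_dotProduct, star_trivial] at this
  simpa [dotProduct, sq, mul_comm] using this

lemma dotProduct_transpose_mul_diagonal_mul {m n : ℕ} (V : Matrix (Fin m) (Fin n) ℝ)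
    (w : Fin m → ℝ) (e : Fin n → ℝ) :
    e ⬝ᵥ (Vᵀ * diagonal w * V) *ᵥ e = ∑ i, w i * (V i ⬝ᵥ e) ^ 2 := by
  rw [Matrix.mul_assoc, ← mulVec_mulVec, dotProduct_mulVec, vecMul_transpose, ← mulVec_mulVec]
  simp only [dotProduct, mulVec_diagonal]
  simp only [mulVec, dotProduct]
  exact Finset.sum_congr rfl fun i _ => by ring

/-- Jensen's inequality for the determinant of a reweighted isometry. -/
lemma exp_le_det_of_transpose_mul_self_eq_one {m n : ℕ} {V : Matrix (Fin m) (Fin n) ℝ}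
    (hV : Vᵀ * V = 1) (t : Fin m → ℝ) :
    Real.exp (∑ i, t i * (V i ⬝ᵥ V i)) ≤
      (Vᵀ * diagonal (fun i => Real.exp (t i)) * V).det := by
  set M := Vᵀ * diagonal (fun i => Real.exp (t i)) * V with hMdef
  have hM : M.IsHermitian := by
    simp [hMdef, IsHermitian, conjTranspose_eq_transpose_of_trivial, Matrix.mul_assoc]
  have hone : ∀ k, ∑ i, (V i ⬝ᵥ (hM.eigenvectorBasis k).ofLp) ^ 2 = 1 := by
    intro k
    have h1 := dotProduct_transpose_mul_diagonal_mul V 1 (hM.eigenvectorBasis k).ofLp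
    have h2 := hM.eigenvectorBasis.orthonormal.1 k
    have h3 := EuclideanSpace.real_norm_sq_eq (hM.eigenvectorBasis k)
    rw [h2] at h3
    simp only [Pi.one_apply, one_mul] at h1
    simp only [Pi.one_def, diagonal_one, Matrix.mul_one, hV, one_mulVec] at h1
    rw [← h1]
    simp only [dotProduct, ← sq]
    simpa using h3.symm
  have hev : ∀ k, hM.eigenvalues k =
      ∑ i, Real.exp (t i) * (V i ⬝ᵥ (hM.eigenvectorBasis k).ofLp) ^ 2 := by
    intro k
    rw [hM.eigenvalues_eq k, ← dotProduct_transpose_mul_diagonal_mul]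
    simp [hMdef]
  have key : ∀ k, Real.exp (∑ i, t i * (V i ⬝ᵥ (hM.eigenvectorBasis k).ofLp) ^ 2) ≤
      hM.eigenvalues k := by
    intro k
    have := convexOn_exp.map_sum_le (t := Finset.univ) (p := t)
      (w := fun i => (V i ⬝ᵥ (hM.eigenvectorBasis k).ofLp) ^ 2) (fun i _ => sq_nonneg _) (hone k)
      (fun i _ => Set.mem_univ _)
    simpa [hev, mul_comm] using this
  have : ∑ i, t i * (V i ⬝ᵥ V i) =
      ∑ k, ∑ i, t i * (V i ⬝ᵥ (hM.eigenvectorBasis k).ofLp) ^ 2 := by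
    rw [Finset.sum_comm]
    simp only [← Finset.mul_sum, dotProduct_sq_sum_eigenvectorBasis hM]
  rw [this, Real.exp_sum, hM.det_eq_prod_eigenvalues]
  exact Finset.prod_le_prod (fun k _ => (Real.exp_pos _).le) (fun k _ => key k)

/-- The orthogonal projection onto the range of a matrix of full column rank. -/
noncomputable def rangeProj {m n : ℕ} (C : Matrix (Fin m) (Fin n) ℝ) :
    Matrix (Fin m) (Fin m) ℝ :=
  C * (Cᵀ * C)⁻¹ * Cᵀ

lemma det_mul_exp_le_det {m n : ℕ} {C : Matrix (Fin m) (Fin n) ℝ} (hC : (Cᵀ * C).PosDef)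
    (t : Fin m → ℝ) :
    (Cᵀ * C).det * Real.exp (∑ i, t i * rangeProj C i i) ≤
      (Cᵀ * diagonal (fun i => Real.exp (t i)) * C).det := by
  obtain ⟨R, hR, hCR⟩ := hC.exists_det_ne_zero_eq_transpose_mul_self
  have hu : IsUnit R.det := isUnit_iff_ne_zero.mpr hR
  have hut : IsUnit Rᵀ.det := by rwa [det_transpose]
  have hinv : (Rᵀ)⁻¹ * Cᵀ * (C * R⁻¹) = 1 := by
    rw [Matrix.mul_assoc, ← Matrix.mul_assoc Cᵀ, hCR, Matrix.mul_assoc,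
      mul_nonsing_inv _ hu, Matrix.mul_one, nonsing_inv_mul _ hut]
  have hV : (C * R⁻¹)ᵀ * (C * R⁻¹) = 1 := by
    rw [transpose_mul, transpose_nonsing_inv, hinv]
  have hP : ∀ i, rangeProj C i i = (C * R⁻¹) i ⬝ᵥ (C * R⁻¹) i := by
    intro i
    have : rangeProj C = (C * R⁻¹) * (C * R⁻¹)ᵀ := by
      rw [rangeProj, hCR, Matrix.mul_inv_rev, transpose_mul, transpose_nonsing_inv]
      simp only [Matrix.mul_assoc]
    rw [this]
    rfl
  have := exp_le_det_of_transpose_mul_self_eq_one hV t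
  have hd : ((C * R⁻¹)ᵀ * diagonal (fun i => Real.exp (t i)) * (C * R⁻¹)).det =
      (Cᵀ * diagonal (fun i => Real.exp (t i)) * C).det / (R.det) ^ 2 := by
    rw [transpose_mul, show R⁻¹ᵀ * Cᵀ * diagonal (fun i => Real.exp (t i)) * (C * R⁻¹) =
      R⁻¹ᵀ * (Cᵀ * diagonal (fun i => Real.exp (t i)) * C) * R⁻¹ by simp only [Matrix.mul_assoc],
      det_mul, det_mul, det_transpose, det_nonsing_inv, Ring.inverse_eq_inv']
    field_simp
  rw [hd, le_div_iff₀ (by positivity)] at this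
  simp only [hP]
  rw [hCR, det_mul, det_transpose]
  linarith

section RangeProj

variable {m n : ℕ} {C : Matrix (Fin m) (Fin n) ℝ}

lemma rangeProj_transpose : (rangeProj C)ᵀ = rangeProj C := by
  simp [rangeProj, transpose_nonsing_inv, Matrix.mul_assoc]

lemma rangeProj_mul_self (hC : (Cᵀ * C).PosDef) : rangeProj C * rangeProj C = rangeProj C := by
  have hu : IsUnit (Cᵀ * C).det := isUnit_iff_ne_zero.mpr hC.det_pos.ne'
  rw [rangeProj, show C * (Cᵀ * C)⁻¹ * Cᵀ * (C * (Cᵀ * C)⁻¹ * Cᵀ) =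
    C * ((Cᵀ * C)⁻¹ * (Cᵀ * C)) * (Cᵀ * C)⁻¹ * Cᵀ by simp only [Matrix.mul_assoc],
    nonsing_inv_mul _ hu, Matrix.mul_one]

lemma trace_rangeProj (hC : (Cᵀ * C).PosDef) : (rangeProj C).trace = n := by
  have hu : IsUnit (Cᵀ * C).det := isUnit_iff_ne_zero.mpr hC.det_pos.ne'
  rw [rangeProj, Matrix.mul_assoc, trace_mul_comm, Matrix.mul_assoc, nonsing_inv_mul _ hu,
    trace_one, Fintype.card_fin]

lemma sum_rangeProj_sq (hC : (Cᵀ * C).PosDef) (i : Fin m) :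
    ∑ j, rangeProj C i j ^ 2 = rangeProj C i i := by
  conv_rhs => rw [← rangeProj_mul_self hC, Matrix.mul_apply]
  refine Finset.sum_congr rfl fun j _ => ?_
  rw [sq, ← congrFun (congrFun (rangeProj_transpose (C := C)) j) i, transpose_apply]

lemma rangeProj_diag_nonneg (hC : (Cᵀ * C).PosDef) (i : Fin m) : 0 ≤ rangeProj C i i :=
  sum_rangeProj_sq hC i ▸ Finset.sum_nonneg fun _ _ => sq_nonneg _

lemma rangeProj_sq_le (hC : (Cᵀ * C).PosDef) (i j : Fin m) :
    rangeProj C i j ^ 2 ≤ rangeProj C i i :=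
  sum_rangeProj_sq hC i ▸
    Finset.single_le_sum (f := fun j => rangeProj C i j ^ 2) (fun _ _ => sq_nonneg _)
      (Finset.mem_univ j)

lemma rangeProj_diag_le_one (hC : (Cᵀ * C).PosDef) (i : Fin m) : rangeProj C i i ≤ 1 := by
  nlinarith [rangeProj_sq_le hC i i]

lemma rangeProj_le_one (hC : (Cᵀ * C).PosDef) (i j : Fin m) : rangeProj C i j ≤ 1 := by
  nlinarith [rangeProj_sq_le hC i j, rangeProj_diag_le_one hC i]

lemma sum_rangeProj_diag (hC : (Cᵀ * C).PosDef) : ∑ i, rangeProj C i i = n :=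
  trace_rangeProj hC

lemma sum_rangeProj_diag_sq_le (hC : (Cᵀ * C).PosDef) : ∑ i, rangeProj C i i ^ 2 ≤ n := by
  rw [← sum_rangeProj_diag hC]
  exact Finset.sum_le_sum fun i _ => rangeProj_sq_le hC i i

lemma sum_rangeProj_cube_le (hC : (Cᵀ * C).PosDef) : ∑ i, ∑ j, rangeProj C i j ^ 3 ≤ n := by
  rw [← sum_rangeProj_diag hC]
  refine Finset.sum_le_sum fun i _ => ?_
  rw [← sum_rangeProj_sq hC]
  refine Finset.sum_le_sum fun j _ => ?_
  nlinarith [rangeProj_le_one hC i j, sq_nonneg (rangeProj C i j)]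

lemma dotProduct_rangeProj_mulVec_le (hC : (Cᵀ * C).PosDef) (v : Fin m → ℝ) :
    v ⬝ᵥ rangeProj C *ᵥ v ≤ v ⬝ᵥ v := by
  have h1 : (rangeProj C *ᵥ v) ⬝ᵥ (rangeProj C *ᵥ v) = v ⬝ᵥ rangeProj C *ᵥ v := by
    rw [dotProduct_mulVec, ← mulVec_transpose, rangeProj_transpose, mulVec_mulVec,
      rangeProj_mul_self hC, dotProduct_comm]
  have h2 : 0 ≤ (v - rangeProj C *ᵥ v) ⬝ᵥ (v - rangeProj C *ᵥ v) :=
    Finset.sum_nonneg fun i _ => mul_self_nonneg _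
  rw [sub_dotProduct, dotProduct_sub, dotProduct_sub, h1,
    dotProduct_comm (rangeProj C *ᵥ v) v] at h2
  linarith

lemma sum_diag_mul_rangeProj_le (hC : (Cᵀ * C).PosDef) :
    ∑ i, ∑ j, rangeProj C i i * rangeProj C j j * rangeProj C i j ≤ n := by
  have h := dotProduct_rangeProj_mulVec_le hC (fun i => rangeProj C i i)
  refine le_trans (le_of_eq ?_) (h.trans (le_trans (le_of_eq ?_) (sum_rangeProj_diag_sq_le hC)))
  · simp only [dotProduct, mulVec, Finset.mul_sum]
    exact Finset.sum_congr rfl fun i _ => Finset.sum_congr rfl fun j _ => by ring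
  · simp [dotProduct, sq]

end RangeProj

section GaussianStep

variable {n m : ℕ} {a : Fin m → Fin n → ℝ} {b : Fin m → ℝ} {x : Fin n → ℝ} {r : ℝ}

/-- The matrix with rows `aᵢ / (aᵢᵀx - bᵢ)`. -/
noncomputable def slackMat (a : Fin m → Fin n → ℝ) (b : Fin m → ℝ) (x : Fin n → ℝ) :
    Matrix (Fin m) (Fin n) ℝ :=
  Matrix.of fun i j => (a i ⬝ᵥ x - b i)⁻¹ * a i j

lemma slackMat_mulVec (y : Fin n → ℝ) (i : Fin m) :
    (slackMat a b x *ᵥ y) i = (a i ⬝ᵥ x - b i)⁻¹ * (a i ⬝ᵥ y) := by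
  simp [slackMat, mulVec, dotProduct, Finset.mul_sum, mul_assoc]

lemma one_add_slackMat_mulVec_sub (hx : x ∈ intK a b) (z : Fin n → ℝ) (i : Fin m) :
    1 + (slackMat a b x *ᵥ (z - x)) i = (a i ⬝ᵥ x - b i)⁻¹ * (a i ⬝ᵥ z - b i) := by
  have : a i ⬝ᵥ x - b i ≠ 0 := (sub_pos.mpr (hx i)).ne'
  rw [slackMat_mulVec, dotProduct_sub]
  field_simp
  ring

lemma Hmat_eq_slackMat : Hmat a b x = (slackMat a b x)ᵀ * slackMat a b x := by
  ext j k
  simp only [Hmat, Matrix.sum_apply, Matrix.smul_apply, vecMulVec_apply, Matrix.mul_apply,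
    transpose_apply, slackMat, of_apply, smul_eq_mul]
  exact Finset.sum_congr rfl fun i _ => by rw [sq, mul_inv]; ring

lemma Hmat_eq_slackMat_diagonal (hx : x ∈ intK a b) (z : Fin n → ℝ) :
    Hmat a b z = (slackMat a b x)ᵀ *
      diagonal (fun i => ((1 + (slackMat a b x *ᵥ (z - x)) i) ^ 2)⁻¹) * slackMat a b x := by
  ext j k
  simp only [one_add_slackMat_mulVec_sub hx]
  rw [Matrix.mul_apply]
  simp only [Hmat, Matrix.sum_apply, Matrix.smul_apply, vecMulVec_apply,
    mul_diagonal, transpose_apply, slackMat, of_apply, smul_eq_mul]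
  refine Finset.sum_congr rfl fun i _ => ?_
  have : a i ⬝ᵥ x - b i ≠ 0 := (sub_pos.mpr (hx i)).ne'
  field_simp

lemma Hmat_posDef (hbdd : Bornology.IsBounded {x : Fin n → ℝ | ∀ i, b i ≤ a i ⬝ᵥ x})
    (hx : x ∈ intK a b) : (Hmat a b x).PosDef := by
  rw [Hmat_eq_slackMat]
  refine PosDef.conjTranspose_mul_self (slackMat a b x) ?_
  intro u v huv
  by_contra hne
  have hy : 0 < ‖u - v‖ := norm_pos_iff.mpr (sub_ne_zero.mpr hne)
  have ha : ∀ i, a i ⬝ᵥ (u - v) = 0 := by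
    intro i
    have h := congrFun huv i
    rw [slackMat_mulVec, slackMat_mulVec] at h
    rw [dotProduct_sub, sub_eq_zero]
    exact mul_left_cancel₀ (inv_ne_zero (sub_pos.mpr (hx i)).ne') h
  obtain ⟨R, hR⟩ := hbdd.exists_norm_le
  have hmem : ∀ t : ℝ, ‖x + t • (u - v)‖ ≤ R := fun t => hR _ fun i => by
    rw [dotProduct_add, dotProduct_smul, ha i, smul_zero, add_zero]
    exact (hx i).le
  have h1 := hmem ((R + ‖x‖ + 1) / ‖u - v‖)
  have h2 := norm_sub_norm_le (((R + ‖x‖ + 1) / ‖u - v‖) • (u - v)) (-x)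
  rw [sub_neg_eq_add, add_comm _ x, norm_neg, norm_smul, Real.norm_eq_abs] at h2
  have h3 := mul_le_mul_of_nonneg_right (le_abs_self ((R + ‖x‖ + 1) / ‖u - v‖)) hy.le
  rw [div_mul_cancel₀ _ hy.ne'] at h3
  linarith

lemma gDen_nonneg (z : Fin n → ℝ) : 0 ≤ gDen r a b x z := by
  unfold gDen; positivity

lemma measurable_gDen : Measurable (gDen r a b x) := by
  unfold gDen mulVec dotProduct
  fun_prop

lemma measurable_gDen_left : Measurable fun z => gDen r a b z x := by
  have hH : ∀ j k, Measurable fun z => Hmat a b z j k := fun j k => by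
    simp only [Hmat, Matrix.sum_apply, Matrix.smul_apply, dotProduct]
    fun_prop
  have hd : Measurable fun z => (Hmat a b z).det := by
    simp only [det_apply]
    fun_prop
  unfold gDen mulVec dotProduct
  fun_prop

lemma measurableSet_intK : MeasurableSet (intK a b) := by
  simp only [intK, Set.ofPred_forall, dotProduct]
  exact MeasurableSet.iInter fun i => measurableSet_lt (by fun_prop) (by fun_prop)

lemma integral_gaussMeas (f : (Fin n → ℝ) → ℝ) :
    ∫ z, f z ∂(gaussMeas r a b x) = ∫ z, gDen r a b x z * f z := by
  rw [gaussMeas, integral_withDensity_eq_integral_toReal_smul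
    measurable_gDen.ennreal_ofReal (by simp)]
  simp only [ENNReal.toReal_ofReal (gDen_nonneg _), smul_eq_mul]

lemma hasGaussianMGF_dotProduct_sub (hn : 1 ≤ n) (hr : 0 < r) (hH : (Hmat a b x).PosDef)
    (w : Fin n → ℝ) :
    HasGaussianMGF (fun z => (Hmat a b x *ᵥ w) ⬝ᵥ (z - x)) (gaussMeas r a b x)
      (r ^ 2 / n * (w ⬝ᵥ Hmat a b x *ᵥ w)) := by
  intro t
  have hn' : (0 : ℝ) < n := by exact_mod_cast hn
  set H := Hmat a b x with hHdef
  have hsymm : ∀ u v : Fin n → ℝ, u ⬝ᵥ H *ᵥ v = v ⬝ᵥ H *ᵥ u := fun u v => by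
    rw [dotProduct_mulVec, ← mulVec_transpose, ← conjTranspose_eq_transpose_of_trivial,
      hH.isHermitian.eq, dotProduct_comm]
  set β : ℝ := n / (2 * r ^ 2) with hβ
  have hβ0 : 0 < β := by positivity
  set s : ℝ := t / (2 * β) with hs
  have hsq : ∀ y : Fin n → ℝ, -β * (y ⬝ᵥ H *ᵥ y) + t * ((H *ᵥ w) ⬝ᵥ y) =
      r ^ 2 / n * (w ⬝ᵥ H *ᵥ w) * t ^ 2 / 2 +
        -β * ((y - s • w) ⬝ᵥ H *ᵥ (y - s • w)) := by
    intro y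
    rw [mulVec_sub, mulVec_smul, dotProduct_sub, sub_dotProduct, sub_dotProduct,
      dotProduct_smul, dotProduct_smul, smul_dotProduct, smul_dotProduct, hsymm w y,
      dotProduct_comm (H *ᵥ w) y, hs, hβ]
    simp only [smul_eq_mul]
    field_simp
    ring
  have hI : ∫ z : Fin n → ℝ, Real.exp (-β * ((z - (x + s • w)) ⬝ᵥ H *ᵥ (z - (x + s • w)))) =
      √(π / β) ^ n / √H.det := by
    rw [integral_sub_right_eq_self (fun z => Real.exp (-β * (z ⬝ᵥ H *ᵥ z))) (x + s • w)]
    exact integral_exp_neg_mul_quadForm hH β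
  have hnorm : ((n : ℝ) / (2 * π * r ^ 2)) ^ ((n : ℝ) / 2) * √(π / β) ^ n = 1 := by
    rw [show (n : ℝ) / (2 * π * r ^ 2) = (π / β)⁻¹ by rw [hβ]; field_simp,
      Real.sqrt_eq_rpow, ← Real.rpow_mul_natCast (by positivity),
      Real.inv_rpow (by positivity), one_div, inv_mul_eq_div (2 : ℝ)]
    exact inv_mul_cancel₀ (by positivity)
  have hdet : 0 < √H.det := Real.sqrt_pos.mpr hH.det_pos
  rw [mgf, integral_gaussMeas]
  simp only [gDen, ← hHdef, ← hβ]
  calc _ = ∫ z, (√H.det * ((n : ℝ) / (2 * π * r ^ 2)) ^ ((n : ℝ) / 2) *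
          Real.exp (r ^ 2 / n * (w ⬝ᵥ H *ᵥ w) * t ^ 2 / 2)) *
          Real.exp (-β * ((z - (x + s • w)) ⬝ᵥ H *ᵥ (z - (x + s • w)))) := by
        refine integral_congr_ae (ae_of_all _ fun z => ?_)
        simp only
        rw [mul_assoc, ← Real.exp_add, hsq, Real.exp_add, sub_sub]
        ring
    _ = _ := by
        rw [integral_const_mul, hI]
        calc _ = (((n : ℝ) / (2 * π * r ^ 2)) ^ ((n : ℝ) / 2) * √(π / β) ^ n) *
              (√H.det / √H.det) * Real.exp (r ^ 2 / n * (w ⬝ᵥ H *ᵥ w) * t ^ 2 / 2) := by ring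
          _ = _ := by rw [hnorm, div_self hdet.ne', one_mul, one_mul]

lemma isProbabilityMeasure_gaussMeas (hn : 1 ≤ n) (hr : 0 < r) (hH : (Hmat a b x).PosDef) :
    IsProbabilityMeasure (gaussMeas r a b x) := by
  have h := hasGaussianMGF_dotProduct_sub hn hr hH 0 0
  simp only [mgf, zero_mul, Real.exp_zero, integral_const, smul_eq_mul, mul_one] at h
  refine ⟨?_⟩
  have h' : ((gaussMeas r a b x) Set.univ).toReal = 1 := by
    simpa [Measure.real] using h
  rwa [ENNReal.toReal_eq_one_iff] at h'

lemma hasGaussianMGF_slackMat (hn : 1 ≤ n) (hr : 0 < r) (hH : (Hmat a b x).PosDef)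
    (q : Fin m → ℝ) :
    HasGaussianMGF (fun z => q ⬝ᵥ (slackMat a b x *ᵥ (z - x))) (gaussMeas r a b x)
      (r ^ 2 / n * (q ⬝ᵥ rangeProj (slackMat a b x) *ᵥ q)) := by
  have hu : IsUnit (Hmat a b x).det := isUnit_iff_ne_zero.mpr hH.det_pos.ne'
  have h := hasGaussianMGF_dotProduct_sub hn hr hH
    ((Hmat a b x)⁻¹ *ᵥ (slackMat a b x)ᵀ *ᵥ q)
  have h1 : Hmat a b x *ᵥ (Hmat a b x)⁻¹ *ᵥ (slackMat a b x)ᵀ *ᵥ q = (slackMat a b x)ᵀ *ᵥ q := by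
    rw [mulVec_mulVec, mul_nonsing_inv _ hu, one_mulVec]
  rw [h1] at h
  have h2 : ∀ z, q ⬝ᵥ (slackMat a b x *ᵥ (z - x)) = ((slackMat a b x)ᵀ *ᵥ q) ⬝ᵥ (z - x) :=
    fun z => by rw [dotProduct_mulVec, mulVec_transpose]
  have h3 : q ⬝ᵥ rangeProj (slackMat a b x) *ᵥ q =
      ((Hmat a b x)⁻¹ *ᵥ (slackMat a b x)ᵀ *ᵥ q) ⬝ᵥ ((slackMat a b x)ᵀ *ᵥ q) := by
    rw [dotProduct_comm _ ((slackMat a b x)ᵀ *ᵥ q), rangeProj, ← Hmat_eq_slackMat,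
      ← mulVec_mulVec, ← mulVec_mulVec, dotProduct_mulVec, mulVec_transpose]
  simpa only [h2, h3] using h

lemma sqrt_det_mul_exp_le (hx : x ∈ intK a b) (hH : (Hmat a b x).PosDef) {z : Fin n → ℝ}
    (hz : ∀ i, -1 < (slackMat a b x *ᵥ (z - x)) i) :
    √(Hmat a b x).det * Real.exp (-∑ i, rangeProj (slackMat a b x) i i *
      (slackMat a b x *ᵥ (z - x)) i) ≤ √(Hmat a b z).det := by
  set C := slackMat a b x with hC
  set u := C *ᵥ (z - x) with hu
  have hH' : (Cᵀ * C).PosDef := Hmat_eq_slackMat (a := a) (b := b) (x := x) ▸ hH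
  have hexp : (fun i => ((1 + u i) ^ 2)⁻¹) = fun i => Real.exp (-2 * Real.log (1 + u i)) := by
    ext i
    have : 0 < 1 + u i := by linarith [hz i]
    rw [show -2 * Real.log (1 + u i) = -(Real.log (1 + u i) * (2 : ℕ)) by push_cast; ring,
      Real.exp_neg, Real.exp_mul, Real.exp_log this, Real.rpow_natCast]
  have h := det_mul_exp_le_det hH' (fun i => -2 * Real.log (1 + u i))
  rw [← hexp, ← Hmat_eq_slackMat_diagonal hx, ← Hmat_eq_slackMat] at h
  have hle : -2 * ∑ i, rangeProj C i i * u i ≤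
      ∑ i, -2 * Real.log (1 + u i) * rangeProj C i i := by
    rw [Finset.mul_sum]
    refine Finset.sum_le_sum fun i _ => ?_
    have h1 := Real.log_le_sub_one_of_pos (show 0 < 1 + u i by linarith [hz i])
    nlinarith [rangeProj_diag_nonneg hH' i]
  refine Real.le_sqrt_of_sq_le (le_trans (le_of_eq ?_)
    ((mul_le_mul_of_nonneg_left (Real.exp_le_exp.mpr hle) hH.det_pos.le).trans h))
  rw [mul_pow, Real.sq_sqrt hH.det_pos.le, ← Real.exp_nat_mul]
  congr 2
  push_cast
  ring

lemma sq_mul_inv_one_add_sq_sub_le {u : ℝ} (hu : -(1 / 2) ≤ u) :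
    ((1 + u) ^ 2)⁻¹ * u ^ 2 - u ^ 2 ≤ -2 * u ^ 3 + 8 * u ^ 4 := by
  have h0 : 1 + u ≠ 0 := by linarith
  have h : 0 < (1 + u) ^ 2 := by positivity
  have key : -2 * u ^ 3 + 8 * u ^ 4 - (((1 + u) ^ 2)⁻¹ * u ^ 2 - u ^ 2) =
      u ^ 4 * ((5 + 4 * u) * (1 + 2 * u)) / (1 + u) ^ 2 := by
    field_simp
    ring
  have : 0 ≤ u ^ 4 * ((5 + 4 * u) * (1 + 2 * u)) / (1 + u) ^ 2 :=
    div_nonneg (mul_nonneg (by positivity) (mul_nonneg (by linarith) (by linarith))) h.le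
  linarith

lemma exp_le_gDen_div_gDen (hn : 1 ≤ n) (hr : 0 < r) (hx : x ∈ intK a b)
    (hH : (Hmat a b x).PosDef) {z : Fin n → ℝ}
    (hz : ∀ i, -(1 / 2) ≤ (slackMat a b x *ᵥ (z - x)) i) :
    Real.exp (-∑ i, rangeProj (slackMat a b x) i i * (slackMat a b x *ᵥ (z - x)) i
        + n / r ^ 2 * ∑ i, (slackMat a b x *ᵥ (z - x)) i ^ 3
        - 4 * (n / r ^ 2) * ∑ i, (slackMat a b x *ᵥ (z - x)) i ^ 4) ≤
      gDen r a b z x / gDen r a b x z := by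
  have hn' : (0 : ℝ) < n := by exact_mod_cast hn
  have hsqrt := sqrt_det_mul_exp_le hx hH (fun i => by linarith [hz i])
  set C := slackMat a b x with hC
  set u := C *ᵥ (z - x) with hu
  have hpos : 0 < gDen r a b x z := by
    have := hH.det_pos
    unfold gDen
    positivity
  have hq1 : (z - x) ⬝ᵥ (Hmat a b x *ᵥ (z - x)) = ∑ i, u i ^ 2 := by
    rw [Hmat_eq_slackMat, ← mulVec_mulVec, dotProduct_mulVec, vecMul_transpose]
    simp [dotProduct, sq, hu, hC]
  have hq2 : (x - z) ⬝ᵥ (Hmat a b z *ᵥ (x - z)) = ∑ i, ((1 + u i) ^ 2)⁻¹ * u i ^ 2 := by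
    rw [Hmat_eq_slackMat_diagonal hx, ← neg_sub z x, mulVec_neg, neg_dotProduct_neg,
      dotProduct_transpose_mul_diagonal_mul]
    rfl
  have hsum : ∑ i, ((1 + u i) ^ 2)⁻¹ * u i ^ 2 - ∑ i, u i ^ 2 ≤
      -2 * ∑ i, u i ^ 3 + 8 * ∑ i, u i ^ 4 := by
    rw [Finset.mul_sum, Finset.mul_sum, ← Finset.sum_sub_distrib, ← Finset.sum_add_distrib]
    exact Finset.sum_le_sum fun i _ => sq_mul_inv_one_add_sq_sub_le (hz i)
  have hexp : n / r ^ 2 * ∑ i, u i ^ 3 - 4 * (n / r ^ 2) * ∑ i, u i ^ 4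
        + -((n : ℝ) / (2 * r ^ 2)) * ∑ i, u i ^ 2 ≤
      -((n : ℝ) / (2 * r ^ 2)) * ∑ i, ((1 + u i) ^ 2)⁻¹ * u i ^ 2 := by
    have h1 := mul_le_mul_of_nonneg_left hsum (show 0 ≤ (n : ℝ) / (2 * r ^ 2) by positivity)
    have h2 : (n : ℝ) / r ^ 2 = 2 * (n / (2 * r ^ 2)) := by field_simp
    rw [h2]
    linarith
  rw [le_div_iff₀ hpos, gDen, gDen, hq1, hq2]
  rw [add_sub_assoc, Real.exp_add]
  calc _ = (√(Hmat a b x).det * Real.exp (-∑ i, rangeProj C i i * u i)) *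
          ((n : ℝ) / (2 * π * r ^ 2)) ^ ((n : ℝ) / 2) *
          (Real.exp (n / r ^ 2 * ∑ i, u i ^ 3 - 4 * (n / r ^ 2) * ∑ i, u i ^ 4) *
            Real.exp (-((n : ℝ) / (2 * r ^ 2)) * ∑ i, u i ^ 2)) := by ring
    _ ≤ _ := by
        rw [← Real.exp_add]
        gcongr

/-- Pointwise bound on the rejection probability by a polynomial in the slacks. -/
lemma one_sub_indicator_le (hn : 1 ≤ n) (hr : 0 < r) (hx : x ∈ intK a b)
    (hH : (Hmat a b x).PosDef) (z : Fin n → ℝ) :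
    1 - (intK a b).indicator (fun z => min 1 (gDen r a b z x / gDen r a b x z)) z ≤
      4 * ∑ i, (slackMat a b x *ᵥ (z - x)) i ^ 2
        + 4 * (n / r ^ 2) * ∑ i, (slackMat a b x *ᵥ (z - x)) i ^ 4
        + ((n / r ^ 2) ^ 2 * (∑ i, (slackMat a b x *ᵥ (z - x)) i ^ 3) ^ 2 / (4 * r) + 4 * r) / 2
        + ((∑ i, rangeProj (slackMat a b x) i i * (slackMat a b x *ᵥ (z - x)) i) ^ 2 / r + r) / 2
        := by
  have hamgm : ∀ s y : ℝ, 0 < s → |y| ≤ (y ^ 2 / s + s) / 2 := by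
    intro s y hs
    rw [← sq_abs, le_div_iff₀ two_pos, ← sub_nonneg]
    have : |y| ^ 2 / s + s - |y| * 2 = (|y| - s) ^ 2 / s := by field_simp; ring
    rw [this]
    positivity
  have h3 := hamgm (4 * r) (n / r ^ 2 * ∑ i, (slackMat a b x *ᵥ (z - x)) i ^ 3) (by positivity)
  have h1 := hamgm r (∑ i, rangeProj (slackMat a b x) i i * (slackMat a b x *ᵥ (z - x)) i) hr
  rw [mul_pow] at h3
  by_cases hz : ∀ i, -(1 / 2) ≤ (slackMat a b x *ᵥ (z - x)) i
  · have hmem : z ∈ intK a b := fun i => by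
      have h := one_add_slackMat_mulVec_sub hx z i
      have hs := inv_pos.mpr (sub_pos.mpr (hx i))
      have : 0 < a i ⬝ᵥ z - b i :=
        pos_of_mul_pos_right (by rw [← h]; linarith [hz i]) hs.le
      linarith
    rw [Set.indicator_of_mem hmem]
    have hratio := exp_le_gDen_div_gDen hn hr hx hH hz
    set A := ∑ i, rangeProj (slackMat a b x) i i * (slackMat a b x *ᵥ (z - x)) i
    set B := n / r ^ 2 * ∑ i, (slackMat a b x *ᵥ (z - x)) i ^ 3
    have hexp := Real.add_one_le_exp
      (-A + B - 4 * (n / r ^ 2) * ∑ i, (slackMat a b x *ᵥ (z - x)) i ^ 4)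
    have hnn : 0 ≤ 4 * ∑ i, (slackMat a b x *ᵥ (z - x)) i ^ 2 := by positivity
    have hnn4 : 0 ≤ 4 * (n / r ^ 2) * ∑ i, (slackMat a b x *ᵥ (z - x)) i ^ 4 := by positivity
    rcases min_cases 1 (gDen r a b z x / gDen r a b x z) with ⟨h, -⟩ | ⟨h, -⟩ <;> rw [h]
    · linarith [abs_nonneg A, abs_nonneg B]
    · linarith [le_abs_self A, neg_abs_le B]
  · push Not at hz
    obtain ⟨i, hi⟩ := hz
    have hle : (slackMat a b x *ᵥ (z - x)) i ^ 2 ≤ ∑ i, (slackMat a b x *ᵥ (z - x)) i ^ 2 :=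
      Finset.single_le_sum (f := fun i => (slackMat a b x *ᵥ (z - x)) i ^ 2)
        (fun _ _ => sq_nonneg _) (Finset.mem_univ i)
    have hind : 0 ≤ (intK a b).indicator
        (fun z => min 1 (gDen r a b z x / gDen r a b x z)) z :=
      Set.indicator_nonneg (fun y _ =>
        le_min zero_le_one (div_nonneg (gDen_nonneg _) (gDen_nonneg _))) z
    have hnn4 : 0 ≤ 4 * (n / r ^ 2) * ∑ i, (slackMat a b x *ᵥ (z - x)) i ^ 4 := by positivity
    have := abs_nonneg (n / r ^ 2 * ∑ i, (slackMat a b x *ᵥ (z - x)) i ^ 3)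
    have := abs_nonneg (∑ i, rangeProj (slackMat a b x) i i * (slackMat a b x *ᵥ (z - x)) i)
    nlinarith

lemma hasGaussianMGF_slackMat_pair (hn : 1 ≤ n) (hr : 0 < r) (hH : (Hmat a b x).PosDef)
    (i j : Fin m) (s : ℝ) :
    HasGaussianMGF
      (fun z => s * (slackMat a b x *ᵥ (z - x)) i + (slackMat a b x *ᵥ (z - x)) j)
      (gaussMeas r a b x)
      (s ^ 2 * (r ^ 2 / n * rangeProj (slackMat a b x) i i)
        + 2 * s * (r ^ 2 / n * rangeProj (slackMat a b x) i j)
        + r ^ 2 / n * rangeProj (slackMat a b x) j j) := by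
  have h := hasGaussianMGF_slackMat hn hr hH (Pi.single i s + Pi.single j 1)
  have hsymm : rangeProj (slackMat a b x) j i = rangeProj (slackMat a b x) i j := by
    rw [← congrFun (congrFun (rangeProj_transpose (C := slackMat a b x)) i) j, transpose_apply]
  simp only [add_dotProduct, mulVec_add, dotProduct_add, single_dotProduct,
    mulVec_single, Pi.smul_apply, op_smul_eq_smul, smul_eq_mul, one_mul, col_apply, hsymm] at h
  convert! h using 1
  ring

lemma hasGaussianMGF_slackMat_apply (hn : 1 ≤ n) (hr : 0 < r) (hH : (Hmat a b x).PosDef)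
    (i : Fin m) :
    HasGaussianMGF (fun z => (slackMat a b x *ᵥ (z - x)) i) (gaussMeas r a b x)
      (r ^ 2 / n * rangeProj (slackMat a b x) i i) := by
  simpa using hasGaussianMGF_slackMat_pair hn hr hH i i 0

lemma integral_sum_slack_sq (hn : 1 ≤ n) (hr : 0 < r) (hH : (Hmat a b x).PosDef) :
    Integrable (fun z => ∑ i, (slackMat a b x *ᵥ (z - x)) i ^ 2) (gaussMeas r a b x) ∧
    ∫ z, ∑ i, (slackMat a b x *ᵥ (z - x)) i ^ 2 ∂(gaussMeas r a b x) = r ^ 2 := by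
  have hG := hasGaussianMGF_slackMat_apply hn hr hH
  have hI : ∀ i ∈ Finset.univ, Integrable (fun z => (slackMat a b x *ᵥ (z - x)) i ^ 2)
      (gaussMeas r a b x) := fun i _ => (hG i).integrable_pow 2
  refine ⟨integrable_finsetSum _ hI, ?_⟩
  rw [integral_finsetSum _ hI]
  have hn' : (0 : ℝ) < n := by exact_mod_cast hn
  have hH' := hH
  rw [Hmat_eq_slackMat] at hH'
  simp only [fun i => (hG i).integral_sq]
  rw [← Finset.mul_sum, sum_rangeProj_diag hH', div_mul_cancel₀ _ hn'.ne']

lemma integral_sum_slack_pow_four_le (hn : 1 ≤ n) (hr : 0 < r) (hH : (Hmat a b x).PosDef) :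
    Integrable (fun z => ∑ i, (slackMat a b x *ᵥ (z - x)) i ^ 4) (gaussMeas r a b x) ∧
    ∫ z, ∑ i, (slackMat a b x *ᵥ (z - x)) i ^ 4 ∂(gaussMeas r a b x) ≤
      3 * (r ^ 2 / n) ^ 2 * n := by
  have hG := hasGaussianMGF_slackMat_apply hn hr hH
  have hI : ∀ i ∈ Finset.univ, Integrable (fun z => (slackMat a b x *ᵥ (z - x)) i ^ 4)
      (gaussMeas r a b x) := fun i _ => (hG i).integrable_pow 4
  refine ⟨integrable_finsetSum _ hI, ?_⟩
  rw [integral_finsetSum _ hI]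
  have hH' := hH
  rw [Hmat_eq_slackMat] at hH'
  simp only [fun i => (hG i).integral_pow_four, mul_pow, ← mul_assoc]
  rw [← Finset.mul_sum]
  exact mul_le_mul_of_nonneg_left (sum_rangeProj_diag_sq_le hH') (by positivity)

lemma integral_sum_slack_cube_sq_le (hn : 1 ≤ n) (hr : 0 < r) (hH : (Hmat a b x).PosDef) :
    Integrable (fun z => (∑ i, (slackMat a b x *ᵥ (z - x)) i ^ 3) ^ 2) (gaussMeas r a b x) ∧
    ∫ z, (∑ i, (slackMat a b x *ᵥ (z - x)) i ^ 3) ^ 2 ∂(gaussMeas r a b x) ≤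
      15 * (r ^ 2 / n) ^ 3 * n := by
  have hG := fun i j => HasGaussianMGF.integral_cube_mul_cube
    (hasGaussianMGF_slackMat_pair hn hr hH i j)
  simp only [sq (∑ i, (slackMat a b x *ᵥ _) i ^ 3), Finset.sum_mul_sum]
  have hI : ∀ i ∈ Finset.univ, Integrable (fun z => ∑ j, (slackMat a b x *ᵥ (z - x)) i ^ 3 *
      (slackMat a b x *ᵥ (z - x)) j ^ 3) (gaussMeas r a b x) :=
    fun i _ => integrable_finsetSum _ fun j _ => (hG i j).1
  refine ⟨integrable_finsetSum _ hI, ?_⟩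
  rw [integral_finsetSum _ hI]
  have hH' := hH
  rw [Hmat_eq_slackMat] at hH'
  have h1 := sum_rangeProj_cube_le hH'
  have h2 := sum_diag_mul_rangeProj_le hH'
  calc _ = ∑ i, ∑ j, (r ^ 2 / n) ^ 3 * (6 * rangeProj (slackMat a b x) i j ^ 3 +
        9 * (rangeProj (slackMat a b x) i i * rangeProj (slackMat a b x) j j *
          rangeProj (slackMat a b x) i j)) := by
        refine Finset.sum_congr rfl fun i _ => ?_
        rw [integral_finsetSum _ fun j _ => (hG i j).1]
        refine Finset.sum_congr rfl fun j _ => ?_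
        rw [(hG i j).2]
        ring
    _ = (r ^ 2 / n) ^ 3 * (6 * ∑ i, ∑ j, rangeProj (slackMat a b x) i j ^ 3 +
        9 * ∑ i, ∑ j, rangeProj (slackMat a b x) i i * rangeProj (slackMat a b x) j j *
          rangeProj (slackMat a b x) i j) := by
        simp only [← Finset.mul_sum, Finset.sum_add_distrib]
    _ ≤ (r ^ 2 / n) ^ 3 * (15 * n) :=
        mul_le_mul_of_nonneg_left (by linarith) (by positivity)
    _ = _ := by ring

lemma integral_sum_diag_mul_slack_sq_le (hn : 1 ≤ n) (hr : 0 < r)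
    (hH : (Hmat a b x).PosDef) :
    Integrable (fun z => (∑ i, rangeProj (slackMat a b x) i i *
      (slackMat a b x *ᵥ (z - x)) i) ^ 2) (gaussMeas r a b x) ∧
    ∫ z, (∑ i, rangeProj (slackMat a b x) i i * (slackMat a b x *ᵥ (z - x)) i) ^ 2
      ∂(gaussMeas r a b x) ≤ r ^ 2 := by
  have hn' : (0 : ℝ) < n := by exact_mod_cast hn
  have hG := hasGaussianMGF_slackMat hn hr hH (fun i => rangeProj (slackMat a b x) i i)
  refine ⟨hG.integrable_pow 2, hG.integral_sq.trans_le ?_⟩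
  have hH' := hH
  rw [Hmat_eq_slackMat] at hH'
  have h : (fun i => rangeProj (slackMat a b x) i i) ⬝ᵥ rangeProj (slackMat a b x) *ᵥ
      (fun i => rangeProj (slackMat a b x) i i) ≤ n := by
    refine (dotProduct_rangeProj_mulVec_le hH' _).trans
      (le_trans (le_of_eq ?_) (sum_rangeProj_diag_sq_le hH'))
    simp [dotProduct, sq]
  calc _ ≤ r ^ 2 / n * n := mul_le_mul_of_nonneg_left h (by positivity)
    _ = r ^ 2 := div_mul_cancel₀ _ hn'.ne'

/-- The rejection probability of the Gaussian Dikin walk is `O(r)`. -/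
lemma one_sub_integral_indicator_le (hn : 1 ≤ n) (hr : 0 < r) (hx : x ∈ intK a b)
    (hH : (Hmat a b x).PosDef) :
    1 - ∫ z, (intK a b).indicator (fun z => min 1 (gDen r a b z x / gDen r a b x z)) z
        ∂(gaussMeas r a b x) ≤ 16 * r ^ 2 + 5 * r := by
  have hn' : (0 : ℝ) < n := by exact_mod_cast hn
  have := isProbabilityMeasure_gaussMeas hn hr hH
  have hmeas : Measurable
      ((intK a b).indicator (fun z => min 1 (gDen r a b z x / gDen r a b x z))) :=
    (measurable_const.min (measurable_gDen_left.div measurable_gDen)).indicator measurableSet_intK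
  have hnn : ∀ z, 0 ≤ min 1 (gDen r a b z x / gDen r a b x z) := fun z =>
    le_min zero_le_one (div_nonneg (gDen_nonneg _) (gDen_nonneg _))
  have h_integrable : Integrable
      ((intK a b).indicator (fun z => min 1 (gDen r a b z x / gDen r a b x z)))
      (gaussMeas r a b x) := by
    refine Integrable.of_bound hmeas.aestronglyMeasurable 1 (ae_of_all _ fun z => ?_)
    rw [Real.norm_of_nonneg (Set.indicator_nonneg (fun z _ => hnn z) z)]
    exact Set.indicator_apply_le' (fun _ => min_le_left _ _) fun _ => zero_le_one
  obtain ⟨I2, J2⟩ := integral_sum_slack_sq hn hr hH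
  obtain ⟨I4, J4⟩ := integral_sum_slack_pow_four_le hn hr hH
  obtain ⟨I3, J3⟩ := integral_sum_slack_cube_sq_le hn hr hH
  obtain ⟨I1, J1⟩ := integral_sum_diag_mul_slack_sq_le hn hr hH
  have K2 := I2.const_mul 4
  have K4 := I4.const_mul (4 * (n / r ^ 2))
  have K3 := ((((I3.const_mul ((n / r ^ 2) ^ 2)).div_const (4 * r)).add
    (integrable_const (4 * r))).div_const 2)
  have K1 := (((I1.div_const r).add (integrable_const r)).div_const 2)
  have hmono := integral_mono ((integrable_const (1 : ℝ)).sub h_integrable)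
    (((K2.add K4).add K3).add K1) (one_sub_indicator_le hn hr hx hH)
  rw [integral_sub' (integrable_const (1 : ℝ)) h_integrable, integral_add' ((K2.add K4).add K3) K1,
    integral_add' (K2.add K4) K3, integral_add' K2 K4] at hmono
  simp only [Pi.add_apply] at hmono
  rw [integral_const_mul, integral_const_mul, integral_div, integral_div,
    integral_add ((I3.const_mul _).div_const _) (integrable_const _),
    integral_add (I1.div_const _) (integrable_const _), integral_div, integral_div,
    integral_const_mul, J2] at hmono
  simp only [integral_const, probReal_univ, smul_eq_mul, one_mul] at hmono
  have e4 : 4 * (n / r ^ 2) * ∫ z, ∑ i, (slackMat a b x *ᵥ (z - x)) i ^ 4 ∂(gaussMeas r a b x) ≤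
      12 * r ^ 2 := by
    refine (mul_le_mul_of_nonneg_left J4 (by positivity)).trans (le_of_eq ?_)
    field_simp
    ring
  have e3 : (n / r ^ 2) ^ 2 * (∫ z, (∑ i, (slackMat a b x *ᵥ (z - x)) i ^ 3) ^ 2
      ∂(gaussMeas r a b x)) / (4 * r) ≤ 4 * r := by
    rw [div_le_iff₀ (by positivity)]
    refine (mul_le_mul_of_nonneg_left J3 (by positivity)).trans ?_
    have : ((n : ℝ) / r ^ 2) ^ 2 * (15 * (r ^ 2 / n) ^ 3 * n) = 15 * r ^ 2 := by field_simp
    rw [this]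
    nlinarith
  have e1 : (∫ z, (∑ i, rangeProj (slackMat a b x) i i * (slackMat a b x *ᵥ (z - x)) i) ^ 2
      ∂(gaussMeas r a b x)) / r ≤ r := by
    rw [div_le_iff₀ hr]
    exact J1.trans_eq (sq r)
  linarith

end GaussianStep

/-- The Metropolis filter changes the Gaussian step distribution by at most ε:
1 − E_{z ∼ gₓ}[ 1_{int K}(z) · min{1, g_z(x)/gₓ(z)} ] ≤ ε. -/
theorem metropolis_filter_close {n m : ℕ} (hn : 1 ≤ n)
    (a : Fin m → Fin n → ℝ) (b : Fin m → ℝ)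
    (hbdd : Bornology.IsBounded {x : Fin n → ℝ | ∀ i, b i ≤ a i ⬝ᵥ x})
    (ε : ℝ) (hε0 : 0 < ε) (hε1 : ε ≤ 1/2)
    (r : ℝ) (hr0 : 0 < r)
    (hr : r ≤ ε / 100 * (Real.log (50 / ε)) ^ (-(3 : ℝ) / 2))
    (x : Fin n → ℝ) (hx : x ∈ intK a b) :
    1 - ∫ z, Set.indicator (intK a b)
          (fun z => min 1 (gDen r a b z x / gDen r a b x z)) z
        ∂(gaussMeas r a b x) ≤ ε := by
  have hlog : 1 ≤ Real.log (50 / ε) := by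
    rw [Real.le_log_iff_exp_le (by positivity), le_div_iff₀ hε0]
    nlinarith [Real.exp_one_lt_d9, Real.exp_pos 1]
  have hr' : r ≤ ε / 100 := hr.trans (mul_le_of_le_one_right (by positivity)
    (Real.rpow_le_one_of_one_le_of_nonpos hlog (by norm_num)))
  refine (one_sub_integral_indicator_le hn hr0 hx (Hmat_posDef hbdd hx)).trans ?_
  nlinarith
end

section
/- Let ε ∈ (0, 1/2] and suppose r ≤ ε/√(2·log(1/ε)). Fix x in the interior of K, let g ∼ N(0, Iₙ) be a standard Gaussian vector on ℝⁿ, and set z = x + (r/√n)·H(x)^(−1/2)·g. Then Pr[ log det H(z) − log det H(x) ≥ −2ε ] ≥ 1 − ε, where H(z) = ∑ᵢ aᵢaᵢᵀ/(aᵢᵀz − bᵢ)² (which is defined almost surely, since almost surely aᵢᵀz ≠ bᵢ for all i). -/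
open Matrix MeasureTheory ProbabilityTheory Real

/-- The standard Gaussian measure N(0, Iₙ) on ℝⁿ. -/
noncomputable def stdGauss (n : ℕ) : Measure (Fin n → ℝ) :=
  Measure.pi fun _ => gaussianReal 0 1

open scoped NNReal ENNReal

lemma gaussianReal_Ici_self_le_half (μ : ℝ) {v : ℝ≥0} (hv : v ≠ 0) :
    gaussianReal μ v (Set.Ici μ) ≤ 2⁻¹ := by
  have := nullSingletonClass_gaussianReal (μ := μ) hv
  have hsymm : gaussianReal μ v (Set.Ici μ) = gaussianReal μ v (Set.Iic μ) := by
    have h : (gaussianReal μ v).map (fun x ↦ 2 * μ - x) = gaussianReal μ v := by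
      rw [gaussianReal_map_const_sub]; congr 1; ring
    conv_lhs => rw [← h]
    rw [Measure.map_apply (by fun_prop) measurableSet_Ici]
    congr 1
    ext x
    simp only [Set.mem_preimage, Set.mem_Ici, Set.mem_Iic]
    constructor <;> intro h <;> linarith
  have hadd : gaussianReal μ v (Set.Ici μ) + gaussianReal μ v (Set.Ici μ) = 1 := by
    conv_lhs => rw [measure_congr Ioi_ae_eq_Ici.symm]
    nth_rewrite 2 [measure_congr Ioi_ae_eq_Ici]
    rw [hsymm, add_comm, ← Set.compl_Iic, measure_add_measure_compl measurableSet_Iic,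
      measure_univ]
  rw [← two_mul] at hadd
  rw [ENNReal.eq_inv_of_mul_eq_one_left ((mul_comm _ _).trans hadd)]

lemma gaussianReal_zero_Ici_le {v : ℝ≥0} (hv : v ≠ 0) {c : ℝ} (hc : 0 ≤ c) :
    gaussianReal 0 v (Set.Ici c) ≤ ENNReal.ofReal (rexp (-c ^ 2 / (2 * v)) / 2) := by
  have hpdf : ∀ y ∈ Set.Ici c, gaussianPDF 0 v y ≤
      ENNReal.ofReal (rexp (-c ^ 2 / (2 * v))) * gaussianPDF c v y := by
    intro y hy
    rw [gaussianPDF, gaussianPDF, ← ENNReal.ofReal_mul (exp_nonneg _)]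
    refine ENNReal.ofReal_le_ofReal ?_
    rw [gaussianPDFReal, gaussianPDFReal, mul_left_comm, ← exp_add, ← add_div]
    gcongr
    have : c ≤ y := hy
    nlinarith
  calc gaussianReal 0 v (Set.Ici c)
      = ∫⁻ y in Set.Ici c, gaussianPDF 0 v y := gaussianReal_apply 0 hv _
    _ ≤ ∫⁻ y in Set.Ici c, ENNReal.ofReal (rexp (-c ^ 2 / (2 * v))) * gaussianPDF c v y :=
        setLIntegral_mono' measurableSet_Ici hpdf
    _ = ENNReal.ofReal (rexp (-c ^ 2 / (2 * v))) * gaussianReal c v (Set.Ici c) := by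
        rw [lintegral_const_mul _ (measurable_gaussianPDF _ _), gaussianReal_apply c hv]
    _ ≤ ENNReal.ofReal (rexp (-c ^ 2 / (2 * v))) * 2⁻¹ := by
        gcongr; exact gaussianReal_Ici_self_le_half c hv
    _ = ENNReal.ofReal (rexp (-c ^ 2 / (2 * v)) / 2) := by
        rw [ENNReal.ofReal_div_of_pos two_pos, ENNReal.ofReal_ofNat, ENNReal.div_eq_inv_mul, mul_comm]

instance (n : ℕ) : IsProbabilityMeasure (stdGauss n) := by
  unfold stdGauss; infer_instance

lemma stdGauss_map_dotProduct {n : ℕ} (v : Fin n → ℝ) :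
    (stdGauss n).map (fun g ↦ v ⬝ᵥ g) = gaussianReal 0 (v ⬝ᵥ v).toNNReal := by
  have hmeas : Measurable fun g : Fin n → ℝ ↦ v ⬝ᵥ g := by unfold dotProduct; fun_prop
  have := Measure.isProbabilityMeasure_map (μ := stdGauss n) hmeas.aemeasurable
  refine Measure.ext_of_charFun (funext fun t ↦ ?_)
  rw [charFun_gaussianReal, charFun_apply_real, integral_map hmeas.aemeasurable (by fun_prop)]
  have hprod : ∀ g : Fin n → ℝ, Complex.exp (t * (v ⬝ᵥ g : ℝ) * Complex.I) =
      ∏ i, Complex.exp (((t * v i : ℝ) : ℂ) * (g i : ℂ) * Complex.I) := by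
    intro g
    rw [← Complex.exp_sum, dotProduct]
    push_cast
    rw [Finset.mul_sum, Finset.sum_mul]
    simp_rw [mul_assoc]
  simp_rw [hprod, stdGauss]
  rw [integral_fintype_prod_eq_prod
    (f := fun i (y : ℝ) ↦ Complex.exp (((t * v i : ℝ) : ℂ) * (y : ℂ) * Complex.I))]
  simp_rw [← charFun_apply_real, charFun_gaussianReal, ← Complex.exp_sum]
  congr 1
  rw [Real.coe_toNNReal _ (by simpa using dotProduct_star_self_nonneg v)]
  simp only [dotProduct]
  push_cast
  rw [Finset.sum_mul, Finset.sum_div, Finset.sum_sub_distrib]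
  simp only [mul_zero, zero_mul, Finset.sum_const_zero]
  congr 1
  refine Finset.sum_congr rfl fun i _ ↦ ?_
  ring

lemma stdGauss_le_dotProduct_le {n : ℕ} (v : Fin n → ℝ) {V c : ℝ}
    (hvV : v ⬝ᵥ v ≤ V) (hc : 0 < c) :
    stdGauss n {g | c ≤ v ⬝ᵥ g} ≤ ENNReal.ofReal (rexp (-c ^ 2 / (2 * V)) / 2) := by
  have h0 : 0 ≤ v ⬝ᵥ v := by simpa using dotProduct_star_self_nonneg v
  rcases h0.eq_or_lt with h | h
  · have : {g | c ≤ v ⬝ᵥ g} = ∅ := by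
      rw [dotProduct_self_eq_zero.1 h.symm]
      ext; simpa using hc
    simp [this]
  · have hmeas : Measurable fun g : Fin n → ℝ ↦ v ⬝ᵥ g := by unfold dotProduct; fun_prop
    have hmap : stdGauss n {g | c ≤ v ⬝ᵥ g} =
        (stdGauss n).map (fun g ↦ v ⬝ᵥ g) (Set.Ici c) :=
      (Measure.map_apply hmeas measurableSet_Ici).symm
    rw [hmap, stdGauss_map_dotProduct]
    refine (gaussianReal_zero_Ici_le (Real.toNNReal_pos.2 h).ne' hc.le).trans ?_
    rw [Real.coe_toNNReal _ h0]
    refine ENNReal.ofReal_le_ofReal ?_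
    rw [neg_div, neg_div]
    gcongr

section
variable {n m : ℕ} {y : Fin m → Fin n → ℝ}

lemma sum_sq_dotProduct_of_isotropic (hy : ∑ i, vecMulVec (y i) (y i) = 1) (u : Fin n → ℝ) :
    ∑ i, (y i ⬝ᵥ u) ^ 2 = u ⬝ᵥ u := by
  have h := congrArg (fun M ↦ u ⬝ᵥ M *ᵥ u) hy
  simp only [one_mulVec, sum_mulVec, dotProduct_sum, vecMulVec_mulVec] at h
  rw [← h]
  refine Finset.sum_congr rfl fun i _ ↦ ?_
  simp [dotProduct_comm u, sq]

lemma sum_dotProduct_self_of_isotropic (hy : ∑ i, vecMulVec (y i) (y i) = 1) :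
    ∑ i, y i ⬝ᵥ y i = n := by
  have h := congrArg trace hy
  simpa [trace_sum, trace_vecMulVec] using h

lemma dotProduct_self_le_one_of_isotropic (hy : ∑ i, vecMulVec (y i) (y i) = 1) (i : Fin m) :
    y i ⬝ᵥ y i ≤ 1 := by
  have h := sum_sq_dotProduct_of_isotropic hy (y i)
  have h2 := Finset.single_le_sum (f := fun k ↦ (y k ⬝ᵥ y i) ^ 2)
    (fun k _ ↦ sq_nonneg _) (Finset.mem_univ i)
  simp only [h] at h2
  nlinarith

lemma dotProduct_self_weighted_sum_le (hy : ∑ i, vecMulVec (y i) (y i) = 1) :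
    (∑ i, (y i ⬝ᵥ y i) • y i) ⬝ᵥ (∑ i, (y i ⬝ᵥ y i) • y i) ≤ n := by
  set v := ∑ i, (y i ⬝ᵥ y i) • y i with hv
  have hnn : ∀ i, 0 ≤ y i ⬝ᵥ y i := fun i ↦ by simpa using dotProduct_star_self_nonneg (y i)
  have h1 : v ⬝ᵥ v = ∑ i, (y i ⬝ᵥ y i) * (y i ⬝ᵥ v) := by
    conv_lhs => enter [1]; rw [hv]
    simp [sum_dotProduct]
  have hcs := Finset.sum_mul_sq_le_sq_mul_sq Finset.univ (fun i ↦ y i ⬝ᵥ y i) (fun i ↦ y i ⬝ᵥ v)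
  rw [← h1, sum_sq_dotProduct_of_isotropic hy] at hcs
  have h2 : ∑ i, (y i ⬝ᵥ y i) ^ 2 ≤ n := by
    rw [← sum_dotProduct_self_of_isotropic hy]
    refine Finset.sum_le_sum fun i _ ↦ ?_
    nlinarith [hnn i, dotProduct_self_le_one_of_isotropic hy i]
  have h0 : 0 ≤ v ⬝ᵥ v := by simpa using dotProduct_star_self_nonneg v
  rcases h0.eq_or_lt with h | h
  · rw [← h]; positivity
  · nlinarith

/-- Jensen's inequality for the log-determinant along a decomposition of the identity. -/
lemma exp_sum_mul_log_le_det (hy : ∑ i, vecMulVec (y i) (y i) = 1)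
    {w : Fin m → ℝ} (hw : ∀ i, 0 < w i) :
    rexp (∑ i, (y i ⬝ᵥ y i) * log (w i)) ≤ (∑ i, w i • vecMulVec (y i) (y i)).det := by
  set M := ∑ i, w i • vecMulVec (y i) (y i) with hM
  have hH : M.IsHermitian := by
    rw [IsHermitian, hM, conjTranspose_sum]
    simp [transpose_vecMulVec]
  let u : Fin n → Fin n → ℝ := fun j ↦ ⇑(hH.eigenvectorBasis j)
  have huu : ∀ j, u j ⬝ᵥ u j = 1 := fun j ↦ by
    have := hH.eigenvectorBasis.orthonormal.1 j
    have h2 : inner ℝ (hH.eigenvectorBasis j) (hH.eigenvectorBasis j) = 1 := by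
      rw [real_inner_self_eq_norm_sq, this, one_pow]
    rw [EuclideanSpace.inner_eq_star_dotProduct] at h2
    simpa [u] using h2
  have hpar : ∀ z : Fin n → ℝ, ∑ j, (z ⬝ᵥ u j) ^ 2 = z ⬝ᵥ z := fun z ↦ by
    have h := hH.eigenvectorBasis.sum_sq_inner_right (WithLp.toLp 2 z)
    rw [← real_inner_self_eq_norm_sq] at h
    simp only [EuclideanSpace.inner_eq_star_dotProduct] at h
    simpa [u] using h
  have hev : ∀ j, hH.eigenvalues j = ∑ i, (y i ⬝ᵥ u j) ^ 2 * w i := fun j ↦ by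
    have h1 : u j ⬝ᵥ M *ᵥ u j = hH.eigenvalues j := by
      have := hH.mulVec_eigenvectorBasis j
      change M *ᵥ u j = _ • u j at this
      rw [this, dotProduct_smul, huu, smul_eq_mul, mul_one]
    rw [← h1, hM]
    simp only [sum_mulVec, dotProduct_sum, smul_mulVec, vecMulVec_mulVec]
    refine Finset.sum_congr rfl fun i _ ↦ ?_
    simp [dotProduct_comm (u j), sq]
    ring
  have hsum : ∀ j, ∑ i, (y i ⬝ᵥ u j) ^ 2 = 1 := fun j ↦ by
    rw [sum_sq_dotProduct_of_isotropic hy, huu]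
  have hpos : ∀ j, 0 < hH.eigenvalues j := fun j ↦ by
    rw [hev]
    refine (convex_Ioi (0 : ℝ)).sum_mem (fun i _ ↦ sq_nonneg _) (hsum j) (fun i _ ↦ hw i)
  have hlog : ∀ j, ∑ i, (y i ⬝ᵥ u j) ^ 2 * log (w i) ≤ log (hH.eigenvalues j) := fun j ↦ by
    rw [hev]
    exact strictConcaveOn_log_Ioi.concaveOn.le_map_sum (fun i _ ↦ sq_nonneg _) (hsum j)
      (fun i _ ↦ hw i)
  rw [hH.det_eq_prod_eigenvalues]
  simp only [RCLike.ofReal_real_eq_id, id_eq]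
  rw [← le_log_iff_exp_le (Finset.prod_pos fun j _ ↦ hpos j), log_prod fun j _ ↦ (hpos j).ne']
  calc ∑ i, (y i ⬝ᵥ y i) * log (w i) = ∑ j, ∑ i, (y i ⬝ᵥ u j) ^ 2 * log (w i) := by
        rw [Finset.sum_comm]
        refine Finset.sum_congr rfl fun i _ ↦ ?_
        rw [← hpar, Finset.sum_mul]
    _ ≤ _ := Finset.sum_le_sum fun j _ ↦ hlog j
end

lemma mul_Hmat_mul {n m : ℕ} (a : Fin m → Fin n → ℝ) (b : Fin m → ℝ) (z : Fin n → ℝ)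
    {S : Matrix (Fin n) (Fin n) ℝ} (hS : S.IsSymm) :
    S * Hmat a b z * S =
      ∑ i, ((a i ⬝ᵥ z - b i) ^ 2)⁻¹ • vecMulVec (S *ᵥ a i) (S *ᵥ a i) := by
  rw [Hmat, Finset.mul_sum, Finset.sum_mul]
  refine Finset.sum_congr rfl fun i _ ↦ ?_
  rw [mul_smul_comm, smul_mul_assoc, mul_vecMulVec, vecMulVec_mul, ← mulVec_transpose, hS]

/-- The rows `(aᵢᵀx - bᵢ)⁻¹ S aᵢ` of the constraint matrix, normalized at `x`. -/
noncomputable def normalizedRow {n m : ℕ} (a : Fin m → Fin n → ℝ) (b : Fin m → ℝ)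
    (x : Fin n → ℝ) (S : Matrix (Fin n) (Fin n) ℝ) (i : Fin m) : Fin n → ℝ :=
  (a i ⬝ᵥ x - b i)⁻¹ • S *ᵥ a i

section
variable {n m : ℕ} {a : Fin m → Fin n → ℝ} {b : Fin m → ℝ} {x : Fin n → ℝ}
  {S : Matrix (Fin n) (Fin n) ℝ}

lemma sum_vecMulVec_normalizedRow (hS : S.IsSymm) (hSsq : S * S = (Hmat a b x)⁻¹)
    (hdet : (Hmat a b x).det ≠ 0) :
    ∑ i, vecMulVec (normalizedRow a b x S i) (normalizedRow a b x S i) = 1 := by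
  have h1 : S * Hmat a b x * S = 1 := by
    rw [mul_eq_one_comm, ← mul_assoc, hSsq, nonsing_inv_mul _ hdet.isUnit]
  rw [← h1, mul_Hmat_mul _ _ _ hS]
  refine Finset.sum_congr rfl fun i _ ↦ ?_
  rw [normalizedRow, smul_vecMulVec, vecMulVec_smul, smul_smul]
  congr 1
  rw [← mul_inv, sq]

lemma neg_two_mul_le_log_det_sub (hx : x ∈ intK a b) (hS : S.IsSymm)
    (hSsq : S * S = (Hmat a b x)⁻¹) (hdet : (Hmat a b x).det ≠ 0) {ρ ε : ℝ} {g : Fin n → ℝ}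
    (hg : ∀ i, -1 < ρ * (normalizedRow a b x S i ⬝ᵥ g))
    (hsum : ρ * ((∑ i, (normalizedRow a b x S i ⬝ᵥ normalizedRow a b x S i) •
      normalizedRow a b x S i) ⬝ᵥ g) ≤ ε) :
    -(2 * ε) ≤ log (Hmat a b (x + ρ • S *ᵥ g)).det - log (Hmat a b x).det := by
  set y := normalizedRow a b x S with hy
  have hiso := sum_vecMulVec_normalizedRow hS hSsq hdet
  rw [← hy] at hiso
  set t : Fin m → ℝ := fun i ↦ ρ * (y i ⬝ᵥ g) with ht
  have hpos : ∀ i, 0 < 1 + t i := fun i ↦ by linarith [hg i]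
  have hslack : ∀ i, a i ⬝ᵥ (x + ρ • S *ᵥ g) - b i = (a i ⬝ᵥ x - b i) * (1 + t i) := by
    intro i
    have hs : a i ⬝ᵥ x - b i ≠ 0 := (sub_pos.2 (hx i)).ne'
    have h1 : a i ⬝ᵥ S *ᵥ g = (a i ⬝ᵥ x - b i) * (y i ⬝ᵥ g) := by
      rw [hy, normalizedRow, smul_dotProduct, smul_eq_mul, mul_inv_cancel_left₀ hs,
        dotProduct_mulVec, ← mulVec_transpose, hS]
    rw [dotProduct_add, dotProduct_smul, h1, ht, smul_eq_mul]
    ring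
  have hH : S * Hmat a b (x + ρ • S *ᵥ g) * S =
      ∑ i, ((1 + t i) ^ 2)⁻¹ • vecMulVec (y i) (y i) := by
    rw [mul_Hmat_mul _ _ _ hS]
    refine Finset.sum_congr rfl fun i _ ↦ ?_
    rw [hslack, hy, normalizedRow, smul_vecMulVec, vecMulVec_smul, smul_smul, smul_smul]
    congr 1
    rw [mul_pow, mul_inv, sq (a i ⬝ᵥ x - b i), mul_inv]
    ring
  have hexp := exp_sum_mul_log_le_det hiso (w := fun i ↦ ((1 + t i) ^ 2)⁻¹)
    fun i ↦ inv_pos.2 (pow_pos (hpos i) 2)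
  rw [← hH] at hexp
  have hdetS : (S * Hmat a b (x + ρ • S *ᵥ g) * S).det =
      (Hmat a b (x + ρ • S *ᵥ g)).det * (Hmat a b x).det⁻¹ := by
    have h := congrArg det hSsq
    rw [det_mul, det_nonsing_inv, Ring.inverse_eq_inv'] at h
    rw [det_mul, det_mul, ← h]
    ring
  have hprod := (exp_pos _).trans_le hexp
  have hlog := (le_log_iff_exp_le hprod).2 hexp
  rw [hdetS] at hprod hlog
  rw [log_mul (left_ne_zero_of_mul hprod.ne') (inv_ne_zero hdet), log_inv,
    ← sub_eq_add_neg] at hlog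
  refine le_trans ?_ hlog
  have hterm : ∀ i, -2 * ((y i ⬝ᵥ y i) * t i) ≤ (y i ⬝ᵥ y i) * log ((1 + t i) ^ 2)⁻¹ := by
    intro i
    have h0 : 0 ≤ y i ⬝ᵥ y i := by simpa using dotProduct_star_self_nonneg (y i)
    have h1 := log_le_sub_one_of_pos (hpos i)
    rw [log_inv, log_pow]
    push_cast
    nlinarith
  have htot : ρ * ((∑ i, (y i ⬝ᵥ y i) • y i) ⬝ᵥ g) = ∑ i, (y i ⬝ᵥ y i) * t i := by
    rw [sum_dotProduct, Finset.mul_sum]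
    refine Finset.sum_congr rfl fun i _ ↦ ?_
    rw [smul_dotProduct, smul_eq_mul]
    ring
  calc -(2 * ε) ≤ ∑ i, -2 * ((y i ⬝ᵥ y i) * t i) := by
        rw [← Finset.mul_sum, ← htot]; linarith
    _ ≤ _ := Finset.sum_le_sum fun i _ ↦ hterm i

end

lemma log_inv_div_le_inv_sq {ε r : ℝ} (hε0 : 0 < ε) (hε1 : ε ≤ 1 / 2) (hr0 : 0 < r)
    (hr : r ≤ ε / √(2 * log (1 / ε))) :
    log (1 / ε) / ε ^ 2 ≤ 1 / (2 * r ^ 2) := by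
  have hL : 0 < log (1 / ε) := log_pos (by rw [lt_div_iff₀ hε0]; linarith)
  have h := pow_le_pow_left₀ hr0.le hr 2
  rw [div_pow, sq_sqrt (by positivity), le_div_iff₀ (by positivity)] at h
  rw [div_le_div_iff₀ (by positivity) (by positivity)]
  linarith

lemma exp_neg_four_mul_log_inv_le {ε q : ℝ} (hε0 : 0 < ε) (hε1 : ε ≤ 1 / 2) (hq : 1 ≤ q) :
    rexp (-(4 * log (1 / ε) * q)) ≤ ε / q := by
  have hL : 1 / 2 ≤ log (1 / ε) := by
    have := log_le_log two_pos (y := 1 / ε) (by rw [le_div_iff₀ hε0]; linarith)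
    linarith [log_two_gt_d9]
  have hexp : rexp (-log (1 / ε)) = ε := by
    rw [one_div, log_inv, neg_neg, exp_log hε0]
  have hsplit : -(4 * log (1 / ε) * q) = -log (1 / ε) + -((4 * q - 1) * log (1 / ε)) := by ring
  rw [hsplit, exp_add, hexp, div_eq_mul_inv ε q]
  refine mul_le_mul_of_nonneg_left ?_ hε0.le
  rw [exp_neg]
  refine inv_anti₀ (by positivity) ?_
  refine le_trans ?_ (add_one_le_exp _)
  nlinarith

/-- With probability at least 1 − ε over z = x + (r/√n)·H(x)^(−1/2)·g, g ∼ N(0,Iₙ),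
we have log det H(z) − log det H(x) ≥ −2ε.  Here `S`, the inverse square root of
`H(x)`, is characterized as the positive semidefinite matrix with S·S = H(x)⁻¹. -/
theorem logdet_change_whp {n m : ℕ} (hn : 1 ≤ n)
    (a : Fin m → Fin n → ℝ) (b : Fin m → ℝ)
    (hbdd : Bornology.IsBounded {x : Fin n → ℝ | ∀ i, b i ≤ a i ⬝ᵥ x})
    (x : Fin n → ℝ) (hx : x ∈ intK a b)
    (ε : ℝ) (hε0 : 0 < ε) (hε1 : ε ≤ 1/2)
    (r : ℝ) (hr0 : 0 < r) (hr : r ≤ ε / Real.sqrt (2 * Real.log (1/ε)))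
    (S : Matrix (Fin n) (Fin n) ℝ) (hS : S.PosSemidef)
    (hSsq : S * S = (Hmat a b x)⁻¹) :
    ENNReal.ofReal (1 - ε) ≤
      stdGauss n {g | Real.log (Hmat a b (x + (r / Real.sqrt n) • S.mulVec g)).det
          - Real.log (Hmat a b x).det ≥ -(2 * ε)} := by
  have hsymm : S.IsSymm := hS.1
  by_cases hdet : (Hmat a b x).det = 0
  · rw [nonsing_inv_apply_not_isUnit _ (by simpa using hdet)] at hSsq
    have hS0 : S = 0 := by
      rw [← self_mul_conjTranspose_eq_zero, hS.1.eq, hSsq]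
    have huniv : {g | Real.log (Hmat a b (x + (r / Real.sqrt n) • S.mulVec g)).det
          - Real.log (Hmat a b x).det ≥ -(2 * ε)} = Set.univ := by
      ext g
      simp [hS0, hε0.le]
    rw [huniv, measure_univ, ENNReal.ofReal_le_one]
    linarith
  have hiso := sum_vecMulVec_normalizedRow hsymm hSsq hdet
  set y := normalizedRow a b x S with hy
  have hn0 : (0 : ℝ) < n := by exact_mod_cast hn
  set ρ := r / √n with hρ
  have hρ0 : 0 < ρ := by positivity
  have hρsq : ρ ^ 2 = r ^ 2 / n := by rw [hρ, div_pow, sq_sqrt hn0.le]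
  set v := ∑ i, (y i ⬝ᵥ y i) • y i with hv
  have hL : 0 < log (1 / ε) := log_pos (by rw [lt_div_iff₀ hε0]; linarith)
  have hr2 := log_inv_div_le_inv_sq hε0 hε1 hr0 hr
  have hlin : stdGauss n {g | ε / ρ ≤ v ⬝ᵥ g} ≤ ENNReal.ofReal (ε / 2) := by
    refine (stdGauss_le_dotProduct_le v (dotProduct_self_weighted_sum_le hiso)
      (by positivity)).trans (ENNReal.ofReal_le_ofReal ?_)
    gcongr
    rw [← le_log_iff_exp_le hε0]
    have h1 : -(ε / ρ) ^ 2 / (2 * n) = -(1 / (2 * r ^ 2) * ε ^ 2) := by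
      rw [div_pow, hρsq]; field_simp
    rw [div_le_iff₀ (by positivity), one_div, log_inv] at hr2
    rw [h1, one_div]
    rw [one_div] at hr2
    linarith
  have hrow : ∀ i, stdGauss n {g | 1 / ρ ≤ -y i ⬝ᵥ g} ≤
      ENNReal.ofReal (ε / 2 * (y i ⬝ᵥ y i / n)) := by
    intro i
    have h0 : 0 ≤ y i ⬝ᵥ y i := by simpa using dotProduct_star_self_nonneg (y i)
    rcases h0.eq_or_lt with h | h
    · have hempty : {g | 1 / ρ ≤ -y i ⬝ᵥ g} = ∅ := by
        rw [dotProduct_self_eq_zero.1 h.symm]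
        ext; simpa using hρ0
      rw [hempty, measure_empty]
      exact zero_le
    refine (stdGauss_le_dotProduct_le (-y i) (V := y i ⬝ᵥ y i) (by simp)
      (by positivity)).trans (ENNReal.ofReal_le_ofReal ?_)
    have hq : 1 ≤ n / (y i ⬝ᵥ y i) := by
      rw [one_le_div h]
      exact (dotProduct_self_le_one_of_isotropic hiso i).trans (by exact_mod_cast hn)
    have hexponent : -(1 / ρ) ^ 2 / (2 * (y i ⬝ᵥ y i)) ≤
        -(4 * log (1 / ε) * (n / (y i ⬝ᵥ y i))) := by
      have h1 : -(1 / ρ) ^ 2 / (2 * (y i ⬝ᵥ y i)) =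
          -(1 / (2 * r ^ 2) * (n / (y i ⬝ᵥ y i))) := by
        rw [div_pow, hρsq]; field_simp
      have h2 : 4 * log (1 / ε) ≤ 1 / (2 * r ^ 2) := by
        refine le_trans ?_ hr2
        rw [le_div_iff₀ (by positivity)]
        nlinarith [mul_nonneg hL.le (show 0 ≤ 1 - 4 * ε ^ 2 by nlinarith)]
      rw [h1]
      gcongr
    have h3 := (exp_le_exp.2 hexponent).trans (exp_neg_four_mul_log_inv_le hε0 hε1 hq)
    rw [div_div_eq_mul_div ε] at h3
    calc _ ≤ ε * (y i ⬝ᵥ y i) / n / 2 := by gcongr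
      _ = _ := by ring
  have hbad : stdGauss n ({g | ε / ρ ≤ v ⬝ᵥ g} ∪ ⋃ i, {g | 1 / ρ ≤ -y i ⬝ᵥ g}) ≤
      ENNReal.ofReal ε := by
    calc _ ≤ stdGauss n {g | ε / ρ ≤ v ⬝ᵥ g} + ∑ i, stdGauss n {g | 1 / ρ ≤ -y i ⬝ᵥ g} :=
          (measure_union_le _ _).trans (by gcongr; exact measure_iUnion_fintype_le _ _)
      _ ≤ ENNReal.ofReal (ε / 2) + ∑ i, ENNReal.ofReal (ε / 2 * (y i ⬝ᵥ y i / n)) := by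
          gcongr with i; exact hrow i
      _ = ENNReal.ofReal ε := by
          have hnn : ∀ i, 0 ≤ y i ⬝ᵥ y i := fun i ↦ by
            simpa using dotProduct_star_self_nonneg (y i)
          rw [← ENNReal.ofReal_sum_of_nonneg fun i _ ↦
              mul_nonneg (by positivity) (div_nonneg (hnn i) hn0.le),
            ← Finset.mul_sum, ← Finset.sum_div, sum_dotProduct_self_of_isotropic hiso,
            div_self hn0.ne', ← ENNReal.ofReal_add (by positivity) (by positivity)]
          congr 1; ring
  rw [ENNReal.ofReal_sub _ hε0.le, ENNReal.ofReal_one, tsub_le_iff_right]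
  calc 1 = stdGauss n Set.univ := measure_univ.symm
    _ ≤ stdGauss n ({g | Real.log (Hmat a b (x + ρ • S.mulVec g)).det
          - Real.log (Hmat a b x).det ≥ -(2 * ε)} ∪ ({g | ε / ρ ≤ v ⬝ᵥ g} ∪ ⋃ i, {g | 1 / ρ ≤ -y i ⬝ᵥ g})) := by
        refine measure_mono fun g _ ↦ ?_
        by_contra hg
        simp only [Set.mem_union, Set.mem_iUnion, not_or, not_exists, Set.mem_ofPred_eq] at hg
        obtain ⟨hg, hg1, hg2⟩ := hg
        refine hg (neg_two_mul_le_log_det_sub hx hsymm hSsq hdet (fun i ↦ ?_) ?_)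
        · have := hg2 i
          rw [not_le, lt_div_iff₀ hρ0, neg_dotProduct] at this
          linarith
        · rw [not_le, lt_div_iff₀ hρ0] at hg1
          linarith
    _ ≤ _ := (measure_union_le _ _).trans (add_le_add_right hbad _)
end

section
/- Let ε ∈ (0, 1/2] and suppose r ≤ (ε/20)·(log(11/ε))^(−3/2). Fix x in the interior of K, let g ∼ N(0, Iₙ) be a standard Gaussian vector on ℝⁿ, and set z = x + (r/√n)·H(x)^(−1/2)·g. Then Pr[ ‖z − x‖_z² − ‖z − x‖ₓ² ≤ 2ε·r²/n ] ≥ 1 − ε, where ‖v‖_z² = vᵀH(z)v with H(z) = ∑ᵢ aᵢaᵢᵀ/(aᵢᵀz − bᵢ)² (defined almost surely, since almost surely aᵢᵀz ≠ bᵢ for all i). -/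
open Matrix MeasureTheory ProbabilityTheory Real

lemma integrable_pow_gaussianReal (k : ℕ) :
    Integrable (fun x : ℝ => x ^ k) (gaussianReal 0 1) := by
  rcases Nat.eq_zero_or_pos k with rfl | hk
  · simp
  · have h := (memLp_id_gaussianReal (μ := 0) (v := 1) (k : NNReal)).integrable_norm_pow
      (by positivity)
    refine h.mono' (by fun_prop) (Filter.Eventually.of_forall fun x => ?_)
    simp [norm_pow]

lemma integrable_pow_mul_gaussianPDFReal (k : ℕ) :
    Integrable (fun x : ℝ => x ^ k * gaussianPDFReal 0 1 x) := by
  have h := integrable_pow_gaussianReal k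
  rw [gaussianReal_of_var_ne_zero _ one_ne_zero, gaussianPDF_def,
    integrable_withDensity_iff (by fun_prop) (by simp)] at h
  simpa [ENNReal.toReal_ofReal, gaussianPDFReal_nonneg] using h

lemma hasDerivAt_gaussianPDFReal (x : ℝ) :
    HasDerivAt (gaussianPDFReal 0 1) (-(x * gaussianPDFReal 0 1 x)) x := by
  rw [gaussianPDFReal_def]
  have h : HasDerivAt (fun y : ℝ => -(y - 0) ^ 2 / (2 * ((1 : NNReal) : ℝ))) (-x) x := by
    have := (((hasDerivAt_id x).sub_const 0).pow 2).neg.div_const (2 * ((1 : NNReal) : ℝ))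
    refine this.congr_deriv ?_
    simp
    ring
  exact (h.exp.const_mul _).congr_deriv (by ring)

lemma integral_pow_succ_gaussianReal (k : ℕ) :
    ∫ x : ℝ, x ^ (k + 1) ∂(gaussianReal 0 1) = k * ∫ x : ℝ, x ^ (k - 1) ∂(gaussianReal 0 1) := by
  simp only [integral_gaussianReal_eq_integral_smul one_ne_zero, smul_eq_mul]
  have h := integral_mul_deriv_eq_deriv_mul_of_integrable (u := fun x : ℝ => x ^ k)
    (u' := fun x : ℝ => k * x ^ (k - 1)) (v := gaussianPDFReal 0 1)
    (v' := fun x : ℝ => -(x * gaussianPDFReal 0 1 x))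
    (fun x _ => hasDerivAt_pow k x) (fun x _ => hasDerivAt_gaussianPDFReal x)
    (by
      convert (integrable_pow_mul_gaussianPDFReal (k + 1)).neg using 1
      ext x
      simp
      ring)
    (by
      convert (integrable_pow_mul_gaussianPDFReal (k - 1)).const_mul (k : ℝ) using 1
      ext x
      simp
      ring)
    (integrable_pow_mul_gaussianPDFReal k)
  rw [← integral_const_mul]
  calc _ = -∫ x : ℝ, x ^ k * -(x * gaussianPDFReal 0 1 x) := by
        rw [← integral_neg]
        congr 1 with x
        ring
    _ = _ := by
        rw [h, neg_neg]
        congr 1 with x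
        ring

instance inst_s4 (n : ℕ) : IsProbabilityMeasure (stdGauss n) := by
  unfold stdGauss
  infer_instance

lemma eval_monomial_eq_prod {n : ℕ} (s : Fin n →₀ ℕ) (c : ℝ) (g : Fin n → ℝ) :
    MvPolynomial.eval g (MvPolynomial.monomial s c) = c * ∏ j, g j ^ s j := by
  rw [MvPolynomial.eval_monomial, Finsupp.prod_fintype _ _ (by simp)]

lemma integrable_eval_stdGauss {n : ℕ} (p : MvPolynomial (Fin n) ℝ) :
    Integrable (fun g => MvPolynomial.eval g p) (stdGauss n) := by
  induction p using MvPolynomial.induction_on' with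
  | monomial s c =>
    simp only [eval_monomial_eq_prod]
    exact (Integrable.fintype_prod (f := fun j (x : ℝ) => x ^ s j)
      fun j => integrable_pow_gaussianReal (s j)).const_mul c
  | add p q hp hq =>
    simp only [map_add]
    exact hp.add hq

/-- Expectation of a polynomial under the standard Gaussian measure. -/
noncomputable def gaussExp {n : ℕ} : MvPolynomial (Fin n) ℝ →ₗ[ℝ] ℝ where
  toFun p := ∫ g, MvPolynomial.eval g p ∂(stdGauss n)
  map_add' p q := by
    simp only [map_add]
    exact integral_add (integrable_eval_stdGauss p) (integrable_eval_stdGauss q)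
  map_smul' c p := by
    simp only [MvPolynomial.smul_eval, RingHom.id_apply, smul_eq_mul]
    exact integral_const_mul _ _

lemma gaussExp_apply {n : ℕ} (p : MvPolynomial (Fin n) ℝ) :
    gaussExp p = ∫ g, MvPolynomial.eval g p ∂(stdGauss n) := rfl

lemma gaussExp_C {n : ℕ} (c : ℝ) : gaussExp (MvPolynomial.C c : MvPolynomial (Fin n) ℝ) = c := by
  simp [gaussExp_apply]

lemma gaussExp_mono {n : ℕ} {p q : MvPolynomial (Fin n) ℝ}
    (h : ∀ g, MvPolynomial.eval g p ≤ MvPolynomial.eval g q) : gaussExp p ≤ gaussExp q :=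
  integral_mono (integrable_eval_stdGauss p) (integrable_eval_stdGauss q) h

lemma gaussExp_monomial {n : ℕ} (s : Fin n →₀ ℕ) (c : ℝ) :
    gaussExp (MvPolynomial.monomial s c) = c * ∏ j, ∫ x : ℝ, x ^ s j ∂(gaussianReal 0 1) := by
  simp only [gaussExp_apply, eval_monomial_eq_prod]
  rw [integral_const_mul, stdGauss,
    integral_fintype_prod_eq_prod (f := fun j (x : ℝ) => x ^ s j)]

lemma gaussExp_X_mul {n : ℕ} (i : Fin n) (p : MvPolynomial (Fin n) ℝ) :
    gaussExp (MvPolynomial.X i * p) = gaussExp (MvPolynomial.pderiv i p) := by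
  induction p using MvPolynomial.induction_on' with
  | monomial s c =>
    rw [MvPolynomial.pderiv_monomial, mul_comm, MvPolynomial.X, MvPolynomial.monomial_mul,
      gaussExp_monomial, gaussExp_monomial, ← Finset.mul_prod_erase _ _ (Finset.mem_univ i),
      ← Finset.mul_prod_erase Finset.univ
        (fun j => ∫ x : ℝ, x ^ (s - Finsupp.single i 1 : Fin n →₀ ℕ) j ∂(gaussianReal 0 1))
        (Finset.mem_univ i)]
    have h : ∀ j ∈ Finset.univ.erase i,
        ∫ x : ℝ, x ^ (s + Finsupp.single i 1 : Fin n →₀ ℕ) j ∂(gaussianReal 0 1)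
          = ∫ x : ℝ, x ^ (s - Finsupp.single i 1 : Fin n →₀ ℕ) j ∂(gaussianReal 0 1) := by
      intro j hj
      have hij : j ≠ i := Finset.ne_of_mem_erase hj
      simp [Finsupp.single_eq_of_ne hij]
    rw [Finset.prod_congr rfl h]
    simp only [Finsupp.coe_add, Pi.add_apply, Finsupp.single_eq_same, Finsupp.coe_tsub,
      Pi.sub_apply, integral_pow_succ_gaussianReal]
    ring
  | add p q hp hq => rw [mul_add, map_add, map_add, map_add, hp, hq]

/-- The linear form `g ↦ c ⬝ᵥ g` as a polynomial. -/
noncomputable def linForm {n : ℕ} (c : Fin n → ℝ) : MvPolynomial (Fin n) ℝ :=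
  ∑ j, c j • MvPolynomial.X j

/-- The directional derivative along `c` on polynomials. -/
noncomputable def dirDeriv {n : ℕ} (c : Fin n → ℝ) :
    Derivation ℝ (MvPolynomial (Fin n) ℝ) (MvPolynomial (Fin n) ℝ) :=
  ∑ j, c j • MvPolynomial.pderiv j

lemma eval_linForm {n : ℕ} (c g : Fin n → ℝ) :
    MvPolynomial.eval g (linForm c) = c ⬝ᵥ g := by
  simp [linForm, dotProduct, MvPolynomial.smul_eval]

lemma dirDeriv_apply {n : ℕ} (c : Fin n → ℝ) (p : MvPolynomial (Fin n) ℝ) :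
    dirDeriv c p = ∑ j, c j • MvPolynomial.pderiv j p := by
  have h := congrFun (map_sum Derivation.coeFnAddMonoidHom
    (fun j => c j • (MvPolynomial.pderiv j : Derivation ℝ (MvPolynomial (Fin n) ℝ) _))
    Finset.univ) p
  exact h.trans (Finset.sum_apply _ _ _)

lemma dirDeriv_linForm {n : ℕ} (c d : Fin n → ℝ) :
    dirDeriv c (linForm d) = MvPolynomial.C (c ⬝ᵥ d) := by
  classical
  simp [dirDeriv_apply, linForm, MvPolynomial.pderiv_X, Pi.single_apply, dotProduct,
    MvPolynomial.smul_eq_C_mul, mul_comm]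

lemma gaussExp_linForm_mul {n : ℕ} (c : Fin n → ℝ) (p : MvPolynomial (Fin n) ℝ) :
    gaussExp (linForm c * p) = gaussExp (dirDeriv c p) := by
  simp [linForm, dirDeriv_apply, Finset.sum_mul, map_sum, gaussExp_X_mul]

lemma mul_pow_le_pow_succ_add {x y : ℝ} (hx : 0 ≤ x) (hy : 0 ≤ y) (N : ℕ) :
    (N + 1) * (x * y ^ N) ≤ x ^ (N + 1) + N * y ^ (N + 1) := by
  rcases hy.eq_or_lt with rfl | hy
  · rcases N with _ | N
    · simp
    · simpa using pow_nonneg hx _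
  · have h := one_add_mul_le_pow (a := x / y - 1) (by linarith [div_nonneg hx hy.le]) (N + 1)
    rw [add_sub_cancel, div_pow, le_div_iff₀ (by positivity)] at h
    calc _ = (1 + ((N + 1 : ℕ) : ℝ) * (x / y - 1)) * y ^ (N + 1) + N * y ^ (N + 1) := by
          push_cast
          field_simp
          ring
      _ ≤ _ := by linarith

lemma sum_smul_dotProduct_sum_smul {m n : ℕ} (c : Fin m → Fin n → ℝ) (u w : Fin m → ℝ) :
    (∑ i, u i • c i) ⬝ᵥ (∑ j, w j • c j) = ∑ i, ∑ j, u i * w j * (c i ⬝ᵥ c j) := by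
  rw [sum_dotProduct]
  refine Finset.sum_congr rfl fun i _ => ?_
  rw [dotProduct_sum]
  refine Finset.sum_congr rfl fun j _ => ?_
  rw [smul_dotProduct, dotProduct_smul, smul_eq_mul, smul_eq_mul, mul_assoc]

lemma dotProduct_self_nonneg' {n : ℕ} (v : Fin n → ℝ) : 0 ≤ v ⬝ᵥ v :=
  Finset.sum_nonneg fun i _ => mul_self_nonneg (v i)

section ParsevalFrame

variable {m n : ℕ} {c : Fin m → Fin n → ℝ}

lemma sum_smul_dotProduct_self_le (hc : ∀ v, ∑ i, (c i ⬝ᵥ v) ^ 2 = v ⬝ᵥ v) (u : Fin m → ℝ) :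
    (∑ i, u i • c i) ⬝ᵥ (∑ i, u i • c i) ≤ ∑ i, u i ^ 2 := by
  set v := ∑ i, u i • c i with hv
  have h1 : v ⬝ᵥ v = ∑ i, u i * (c i ⬝ᵥ v) := by
    conv_lhs => rw [hv, sum_dotProduct, ← hv]
    simp only [smul_dotProduct, smul_eq_mul]
  have h2 : 0 ≤ ∑ i, (u i - c i ⬝ᵥ v) ^ 2 := Finset.sum_nonneg fun i _ => sq_nonneg _
  have h3 : ∑ i, (u i - c i ⬝ᵥ v) ^ 2
      = ∑ i, u i ^ 2 - 2 * ∑ i, u i * (c i ⬝ᵥ v) + ∑ i, (c i ⬝ᵥ v) ^ 2 := by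
    rw [Finset.mul_sum, ← Finset.sum_sub_distrib, ← Finset.sum_add_distrib]
    exact Finset.sum_congr rfl fun i _ => by ring
  rw [h3, hc, ← h1] at h2
  linarith

lemma dotProduct_self_le_one (hc : ∀ v, ∑ i, (c i ⬝ᵥ v) ^ 2 = v ⬝ᵥ v) (i : Fin m) :
    c i ⬝ᵥ c i ≤ 1 := by
  have h := Finset.single_le_sum (f := fun j => (c j ⬝ᵥ c i) ^ 2) (fun j _ => sq_nonneg _)
    (Finset.mem_univ i)
  rw [hc] at h
  nlinarith

lemma sum_dotProduct_self (hc : ∀ v, ∑ i, (c i ⬝ᵥ v) ^ 2 = v ⬝ᵥ v) :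
    ∑ i, c i ⬝ᵥ c i = n := by
  have h : ∀ j : Fin n, ∑ i, c i j * c i j = 1 := fun j => by
    simpa [dotProduct_single, pow_two] using hc (Pi.single j 1)
  simp only [dotProduct]
  rw [Finset.sum_comm]
  simp [h]

lemma sum_dotProduct_self_sq_le (hc : ∀ v, ∑ i, (c i ⬝ᵥ v) ^ 2 = v ⬝ᵥ v) :
    ∑ i, (c i ⬝ᵥ c i) ^ 2 ≤ n := by
  rw [← sum_dotProduct_self hc]
  refine Finset.sum_le_sum fun i _ => ?_
  nlinarith [dotProduct_self_le_one hc i, dotProduct_self_nonneg' (c i)]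

lemma sum_dotProduct_self_mul_sq_le (hc : ∀ v, ∑ i, (c i ⬝ᵥ v) ^ 2 = v ⬝ᵥ v) (t : Fin m → ℝ) :
    ∑ i, (c i ⬝ᵥ c i) * t i ^ 2 ≤ √n * √(∑ i, t i ^ 4) := by
  refine (Real.sum_mul_le_sqrt_mul_sqrt _ _ _).trans ?_
  simp only [← pow_mul]
  gcongr
  exact sum_dotProduct_self_sq_le hc

lemma sum_pow_six_le (t : Fin m → ℝ) :
    ∑ i, (t i ^ 3) ^ 2 ≤ √(∑ i, t i ^ 4) ^ 3 := by
  have hA : 0 ≤ ∑ i, t i ^ 4 := Finset.sum_nonneg fun i _ => by positivity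
  rw [pow_succ, Real.sq_sqrt hA, Finset.sum_mul]
  refine Finset.sum_le_sum fun i _ => ?_
  have h : t i ^ 2 ≤ √(∑ i, t i ^ 4) := by
    refine Real.le_sqrt_of_sq_le ?_
    rw [← pow_mul]
    exact Finset.single_le_sum (f := fun i => t i ^ 4) (fun j _ => by positivity)
      (Finset.mem_univ i)
  calc (t i ^ 3) ^ 2 = t i ^ 4 * t i ^ 2 := by ring
    _ ≤ _ := by gcongr

/-- The polynomial `g ↦ ∑ᵢ (cᵢ ⬝ᵥ g) ^ d`. -/
noncomputable def powerSum (c : Fin m → Fin n → ℝ) (d : ℕ) : MvPolynomial (Fin n) ℝ :=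
  ∑ i, linForm (c i) ^ d

lemma eval_powerSum (d : ℕ) (g : Fin n → ℝ) :
    MvPolynomial.eval g (powerSum c d) = ∑ i, (c i ⬝ᵥ g) ^ d := by
  simp [powerSum, eval_linForm]

lemma dirDeriv_powerSum (v : Fin n → ℝ) (d : ℕ) :
    dirDeriv v (powerSum c d)
      = ∑ j, MvPolynomial.C (d * (v ⬝ᵥ c j)) * linForm (c j) ^ (d - 1) := by
  simp only [powerSum, map_sum, Derivation.leibniz_pow, dirDeriv_linForm]
  refine Finset.sum_congr rfl fun j _ => ?_
  simp only [nsmul_eq_mul, smul_eq_mul, map_mul, map_natCast]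
  ring

lemma gaussExp_powerSum_mul_pow (d e k : ℕ) :
    gaussExp (powerSum c (d + 1) * powerSum c (e + 1) ^ k)
      = gaussExp (∑ i, MvPolynomial.C (d * (c i ⬝ᵥ c i)) * linForm (c i) ^ (d - 1)
            * powerSum c (e + 1) ^ k
          + (k : MvPolynomial (Fin n) ℝ) * powerSum c (e + 1) ^ (k - 1)
            * ∑ i, ∑ j, MvPolynomial.C ((e + 1) * (c i ⬝ᵥ c j))
              * (linForm (c i) ^ d * linForm (c j) ^ e)) := by
  have h : powerSum c (d + 1) * powerSum c (e + 1) ^ k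
      = ∑ i, linForm (c i) * (linForm (c i) ^ d * powerSum c (e + 1) ^ k) := by
    conv_lhs => rw [powerSum, Finset.sum_mul]
    exact Finset.sum_congr rfl fun i _ => by ring
  rw [h, map_sum, map_add, Finset.mul_sum, map_sum, map_sum, ← Finset.sum_add_distrib]
  refine Finset.sum_congr rfl fun i _ => ?_
  rw [gaussExp_linForm_mul, ← map_add]
  congr 1
  simp only [Derivation.leibniz, Derivation.leibniz_pow, dirDeriv_powerSum, dirDeriv_linForm,
    nsmul_eq_mul, smul_eq_mul, map_mul, map_natCast, Nat.add_sub_cancel, Finset.mul_sum]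
  rw [add_comm]
  congr 1
  · ring
  · refine Finset.sum_congr rfl fun j _ => ?_
    simp only [map_add, map_natCast, map_one, Nat.cast_add, Nat.cast_one]
    ring

lemma gaussExp_powerSum_four_pow_le (hc : ∀ v, ∑ i, (c i ⬝ᵥ v) ^ 2 = v ⬝ᵥ v) (k : ℕ) :
    gaussExp (powerSum c 4 ^ (k + 1)) ≤ (3 * √n + 4 * k) ^ (2 * (k + 1)) := by
  set M : ℝ := 3 * √n + 4 * k with hM
  have hM0 : 0 ≤ M := by positivity
  have key : gaussExp (powerSum c 4 ^ (k + 1))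
      ≤ gaussExp ((1 / (2 * k + 2) : ℝ) • (MvPolynomial.C (M ^ (2 * (k + 1)))
        + (2 * k + 1 : ℝ) • powerSum c 4 ^ (k + 1))) := by
    rw [pow_succ', gaussExp_powerSum_mul_pow 3 3 k]
    refine gaussExp_mono fun g => ?_
    simp only [map_add, map_mul, map_sum, map_pow, eval_powerSum, eval_linForm,
      MvPolynomial.smul_eval, MvPolynomial.eval_C, map_natCast]
    set t : Fin m → ℝ := fun i => c i ⬝ᵥ g with ht
    have hA : 0 ≤ ∑ i, t i ^ 4 := Finset.sum_nonneg fun i _ => by positivity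
    have h1 := sum_dotProduct_self_mul_sq_le hc t
    have h2 := (sum_smul_dotProduct_self_le hc fun i => t i ^ 3).trans (sum_pow_six_le t)
    rw [sum_smul_dotProduct_sum_smul] at h2
    set s := √(∑ i, t i ^ 4) with hs
    have hs0 : 0 ≤ s := Real.sqrt_nonneg _
    have hAs : ∑ i, t i ^ 4 = s ^ 2 := (Real.sq_sqrt hA).symm
    have hy := mul_pow_le_pow_succ_add hM0 hs0 (2 * k + 1)
    have e1 : ∑ i, ((3 : ℕ) : ℝ) * (c i ⬝ᵥ c i) * t i ^ (3 - 1) * (∑ i, t i ^ 4) ^ k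
        = 3 * (∑ i, (c i ⬝ᵥ c i) * t i ^ 2) * s ^ (2 * k) := by
      rw [hAs, ← pow_mul, Finset.mul_sum, Finset.sum_mul]
      exact Finset.sum_congr rfl fun i _ => by push_cast; ring
    have e2 : ∑ i, ∑ j, (((3 : ℕ) : ℝ) + 1) * (c i ⬝ᵥ c j) * (t i ^ 3 * t j ^ 3)
        = 4 * ∑ i, ∑ j, t i ^ 3 * t j ^ 3 * (c i ⬝ᵥ c j) := by
      simp only [Finset.mul_sum]
      exact Finset.sum_congr rfl fun i _ => Finset.sum_congr rfl fun j _ => by norm_num; ring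
    have e3 : (k : ℝ) * (∑ i, t i ^ 4) ^ (k - 1) * (4 * s ^ 3) = 4 * k * s ^ (2 * k + 1) := by
      rw [hAs]
      rcases k with _ | k
      · simp
      · rw [Nat.add_sub_cancel]
        ring
    have b2 : (k : ℝ) * (∑ i, t i ^ 4) ^ (k - 1)
          * ∑ i, ∑ j, (((3 : ℕ) : ℝ) + 1) * (c i ⬝ᵥ c j) * (t i ^ 3 * t j ^ 3)
        ≤ 4 * k * s ^ (2 * k + 1) := by
      rw [← e3, e2]
      gcongr
    have b1 : 3 * (∑ i, (c i ⬝ᵥ c i) * t i ^ 2) * s ^ (2 * k) ≤ 3 * √n * s ^ (2 * k + 1) := by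
      calc _ ≤ 3 * (√n * s) * s ^ (2 * k) := by gcongr
        _ = _ := by ring
    refine (add_le_add (e1.trans_le b1) b2).trans ?_
    rw [hAs, ← pow_succ', ← pow_mul, div_mul_eq_mul_div, one_mul, le_div_iff₀ (by positivity)]
    push_cast at hy
    have e4 : (3 * √n * s ^ (2 * k + 1) + 4 * k * s ^ (2 * k + 1)) * (2 * k + 2)
        = (2 * k + 1 + 1) * (M * s ^ (2 * k + 1)) := by
      rw [hM]
      ring
    rw [e4]
    exact hy
  rw [map_smul, map_add, map_smul, gaussExp_C, smul_eq_mul, smul_eq_mul, div_mul_eq_mul_div,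
    one_mul, le_div_iff₀ (by positivity)] at key
  linarith

lemma gaussExp_linForm_combination_mul (w : Fin m → ℝ) (d k : ℕ) :
    gaussExp (∑ i, MvPolynomial.C (w i) * linForm (c i) * powerSum c (d + 1) ^ k)
      = gaussExp ((k : MvPolynomial (Fin n) ℝ) * powerSum c (d + 1) ^ (k - 1)
          * ∑ i, ∑ j, MvPolynomial.C ((d + 1) * w i * (c i ⬝ᵥ c j)) * linForm (c j) ^ d) := by
  rw [map_sum, Finset.mul_sum, map_sum]
  refine Finset.sum_congr rfl fun i _ => ?_
  rw [mul_assoc, mul_left_comm, gaussExp_linForm_mul]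
  congr 1
  rw [MvPolynomial.C_mul', Derivation.map_smul]
  simp only [Derivation.leibniz_pow, dirDeriv_powerSum,
    nsmul_eq_mul, smul_eq_mul, Nat.add_sub_cancel, Finset.mul_sum, Finset.smul_sum]
  refine Finset.sum_congr rfl fun j _ => ?_
  simp only [MvPolynomial.smul_eq_C_mul, map_mul, map_add, map_natCast, map_one, Nat.cast_add,
    Nat.cast_one]
  ring

lemma gaussExp_powerSum_three_step (hc : ∀ v, ∑ i, (c i ⬝ᵥ v) ^ 2 = v ⬝ᵥ v) (k : ℕ) :
    gaussExp (powerSum c 3 ^ (2 * (k + 1)))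
      ≤ gaussExp ((2 * k + 1 : ℝ) • (powerSum c 3 ^ (2 * k)
          * (MvPolynomial.C (3 * n : ℝ) + (6 : ℝ) • powerSum c 4))) := by
  have h2 : (∑ i, MvPolynomial.C (((2 : ℕ) : ℝ) * (c i ⬝ᵥ c i)) * linForm (c i) ^ (2 - 1)
        * powerSum c 3 ^ (2 * k + 1))
      = ∑ i, MvPolynomial.C (2 * (c i ⬝ᵥ c i)) * linForm (c i) * powerSum c 3 ^ (2 * k + 1) := by
    refine Finset.sum_congr rfl fun i _ => ?_
    rw [Nat.add_sub_cancel 1 1, pow_one, Nat.cast_ofNat]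
  rw [show 2 * (k + 1) = 2 * k + 1 + 1 by ring, pow_succ', gaussExp_powerSum_mul_pow 2 2 (2 * k + 1),
    map_add, h2, gaussExp_linForm_combination_mul, ← map_add]
  refine gaussExp_mono fun g => ?_
  simp only [map_add, map_mul, map_sum, map_pow, eval_powerSum, eval_linForm,
    MvPolynomial.smul_eval, MvPolynomial.eval_C, map_natCast, Nat.add_sub_cancel]
  set t : Fin m → ℝ := fun i => c i ⬝ᵥ g with ht
  set V := ∑ i, t i ^ 2 • c i with hV
  set W := ∑ i, (c i ⬝ᵥ c i) • c i with hW
  have hVV : V ⬝ᵥ V ≤ ∑ i, t i ^ 4 := by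
    refine (sum_smul_dotProduct_self_le hc fun i => t i ^ 2).trans_eq ?_
    exact Finset.sum_congr rfl fun i _ => by ring
  have hWW : W ⬝ᵥ W ≤ n := (sum_smul_dotProduct_self_le hc _).trans
    (sum_dotProduct_self_sq_le hc)
  have hWV : 2 * (W ⬝ᵥ V) ≤ W ⬝ᵥ W + V ⬝ᵥ V := by
    have h := dotProduct_self_nonneg' (W - V)
    rw [sub_dotProduct, dotProduct_sub, dotProduct_sub, dotProduct_comm V W] at h
    linarith
  have e1 : ∑ i, ∑ j, (((2 : ℕ) : ℝ) + 1) * (2 * (c i ⬝ᵥ c i)) * (c i ⬝ᵥ c j) * t j ^ 2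
      = 6 * (W ⬝ᵥ V) := by
    rw [hW, hV, sum_smul_dotProduct_sum_smul]
    simp only [Finset.mul_sum]
    exact Finset.sum_congr rfl fun i _ => Finset.sum_congr rfl fun j _ => by push_cast; ring
  have e2 : ∑ i, ∑ j, (((2 : ℕ) : ℝ) + 1) * (c i ⬝ᵥ c j) * (t i ^ 2 * t j ^ 2)
      = 3 * (V ⬝ᵥ V) := by
    rw [hV, sum_smul_dotProduct_sum_smul]
    simp only [Finset.mul_sum]
    exact Finset.sum_congr rfl fun i _ => Finset.sum_congr rfl fun j _ => by push_cast; ring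
  rw [e1, e2, ← mul_add, mul_assoc]
  push_cast
  have hp : 0 ≤ (∑ i, t i ^ 3) ^ (2 * k) := by
    rw [pow_mul]
    positivity
  refine mul_le_mul_of_nonneg_left (mul_le_mul_of_nonneg_left ?_ hp) (by positivity)
  linarith

lemma add_mul_pow_succ_le {p q y : ℝ} (hp : 0 ≤ p) (hq : 0 ≤ q) (hpq : 0 < p + q) (hy : 0 ≤ y)
    (N : ℕ) : (p + q * y) ^ (N + 1) ≤ (p + q) ^ N * (p + q * y ^ (N + 1)) := by
  have h := (convexOn_pow (𝕜 := ℝ) (N + 1)).2 (Set.mem_Ici.2 zero_le_one) (Set.mem_Ici.2 hy)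
    (by positivity : 0 ≤ p / (p + q)) (by positivity : 0 ≤ q / (p + q)) (by rw [← add_div, div_self hpq.ne'])
  simp only [smul_eq_mul, mul_one, one_pow] at h
  calc (p + q * y) ^ (N + 1) = (p + q) ^ (N + 1) * (p / (p + q) + q / (p + q) * y) ^ (N + 1) := by
        rw [← mul_pow]
        congr 1
        field_simp
    _ ≤ (p + q) ^ (N + 1) * (p / (p + q) + q / (p + q) * y ^ (N + 1)) := by gcongr
    _ = _ := by
        rw [pow_succ]
        field_simp

lemma gaussExp_add_powerSum_four_pow_le (hc : ∀ v, ∑ i, (c i ⬝ᵥ v) ^ 2 = v ⬝ᵥ v) (hn : 1 ≤ n)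
    (k : ℕ) :
    gaussExp ((MvPolynomial.C (3 * n : ℝ) + (6 : ℝ) • powerSum c 4) ^ (k + 1))
      ≤ (3 * n + 6 * (3 * √n + 4 * k) ^ 2) ^ (k + 1) := by
  set W : ℝ := (3 * √n + 4 * k) ^ 2 with hW
  have hn' : (0 : ℝ) < n := by exact_mod_cast hn
  have hW0 : 0 < W := by positivity
  have hA := gaussExp_powerSum_four_pow_le hc k
  rw [pow_mul, ← hW] at hA
  have key : gaussExp ((MvPolynomial.C (3 * n : ℝ) + (6 : ℝ) • powerSum c 4) ^ (k + 1))
      ≤ gaussExp ((3 * n + 6 * W) ^ k • (MvPolynomial.C (3 * n : ℝ)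
        + (6 * W / W ^ (k + 1)) • powerSum c 4 ^ (k + 1))) := by
    refine gaussExp_mono fun g => ?_
    simp only [map_add, map_pow, eval_powerSum, MvPolynomial.smul_eval, MvPolynomial.eval_C]
    have hs : 0 ≤ ∑ i, (c i ⬝ᵥ g) ^ 4 := Finset.sum_nonneg fun i _ => by positivity
    have h := add_mul_pow_succ_le (p := 3 * n) (q := 6 * W) (by positivity) (by positivity)
      (by positivity) (div_nonneg hs hW0.le) k
    convert h using 2
    · field_simp
    · rw [div_pow]
      ring
  rw [map_smul, map_add, map_smul, gaussExp_C, smul_eq_mul, smul_eq_mul] at key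
  refine key.trans ?_
  rw [pow_succ (3 * (n : ℝ) + 6 * W) k]
  refine mul_le_mul_of_nonneg_left (add_le_add_right ?_ _) (by positivity)
  rw [div_mul_eq_mul_div, div_le_iff₀ (by positivity)]
  gcongr

lemma gaussExp_powerSum_three_pow_le (hc : ∀ v, ∑ i, (c i ⬝ᵥ v) ^ 2 = v ⬝ᵥ v) (hn : 1 ≤ n)
    (k : ℕ) :
    gaussExp (powerSum c 3 ^ (2 * (k + 1))) ≤ (192 * (k + 1) ^ 3 * n) ^ (k + 1) := by
  have hn' : (1 : ℝ) ≤ n := by exact_mod_cast hn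
  have h1 := gaussExp_powerSum_three_step hc k
  set Q := MvPolynomial.C (3 * n : ℝ) + (6 : ℝ) • powerSum c 4 with hQ
  have h2 : gaussExp ((2 * k + 1 : ℝ) • (powerSum c 3 ^ (2 * k) * Q))
      ≤ gaussExp ((1 / (k + 1) : ℝ) • ((2 * k + 1 : ℝ) ^ (k + 1) • Q ^ (k + 1)
        + (k : ℝ) • powerSum c 3 ^ (2 * (k + 1)))) := by
    refine gaussExp_mono fun g => ?_
    have hq : 0 ≤ MvPolynomial.eval g Q := by
      simp only [hQ, map_add, MvPolynomial.smul_eval, MvPolynomial.eval_C, eval_powerSum]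
      positivity
    simp only [map_add, map_mul, map_pow, MvPolynomial.smul_eval]
    rw [div_mul_eq_mul_div, one_mul, le_div_iff₀ (by positivity)]
    have h := mul_pow_le_pow_succ_add (x := (2 * k + 1) * MvPolynomial.eval g Q)
      (y := MvPolynomial.eval g (powerSum c 3) ^ 2) (by positivity) (by positivity) k
    rw [mul_pow, ← pow_mul, ← pow_mul] at h
    linarith
  have h3 := h1.trans h2
  rw [map_smul, map_add, map_smul, map_smul, smul_eq_mul, smul_eq_mul, smul_eq_mul,
    div_mul_eq_mul_div, one_mul, le_div_iff₀ (by positivity)] at h3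
  have h4 := gaussExp_add_powerSum_four_pow_le hc hn k
  have h5 : gaussExp (powerSum c 3 ^ (2 * (k + 1)))
      ≤ (2 * k + 1) ^ (k + 1) * gaussExp (Q ^ (k + 1)) := by linarith
  refine h5.trans ?_
  have hs1 : √(n : ℝ) ^ 2 = n := Real.sq_sqrt (by positivity)
  have hs2 : 1 ≤ √(n : ℝ) := Real.one_le_sqrt.mpr hn'
  calc _ ≤ (2 * k + 1 : ℝ) ^ (k + 1) * (3 * n + 6 * (3 * √n + 4 * k) ^ 2) ^ (k + 1) := by gcongr
    _ = ((2 * k + 1 : ℝ) * (3 * n + 6 * (3 * √n + 4 * k) ^ 2)) ^ (k + 1) := by rw [mul_pow]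
    _ ≤ _ := by
      refine pow_le_pow_left₀ (by positivity) ?_ _
      have h6 : 3 * √(n : ℝ) + 4 * k ≤ (4 * k + 3) * √n := by
        nlinarith [(Nat.cast_nonneg k : (0 : ℝ) ≤ k)]
      calc (2 * k + 1 : ℝ) * (3 * n + 6 * (3 * √n + 4 * k) ^ 2)
          ≤ (2 * k + 1 : ℝ) * (3 * n + 6 * ((4 * k + 3) * √n) ^ 2) := by gcongr
        _ = (2 * k + 1 : ℝ) * (3 + 6 * (4 * k + 3) ^ 2) * n := by
          rw [mul_pow, hs1]
          ring
        _ ≤ _ := by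
          refine mul_le_mul_of_nonneg_right ?_ (by positivity)
          nlinarith [(Nat.cast_nonneg k : (0 : ℝ) ≤ k), sq_nonneg (k : ℝ)]

end ParsevalFrame

lemma exp_mul_le_cube {u : ℝ} (h1 : 3 / 2 ≤ u) (h2 : u ≤ 5) : rexp u * 192 ≤ 324 * u ^ 3 := by
  have he := Real.exp_one_lt_d9
  have ha : rexp (1 / 2) ≤ 119 / 100 * (3 / 2) := by
    refine le_of_pow_le_pow_left₀ (n := 2) (by norm_num) (by norm_num) ?_
    rw [← Real.exp_nat_mul]
    norm_num
    linarith
  have hb : rexp (5 / 3) ≤ 119 / 100 * 5 := by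
    refine le_of_pow_le_pow_left₀ (n := 3) (by norm_num) (by norm_num) ?_
    rw [← Real.exp_nat_mul]
    calc rexp ((3 : ℕ) * (5 / 3)) = rexp 1 ^ 5 := by rw [← Real.exp_nat_mul]; norm_num
      _ ≤ 2.7182818286 ^ 5 := by gcongr
      _ ≤ _ := by norm_num
  have hconv := convexOn_exp.2 (Set.mem_univ (1 / 2)) (Set.mem_univ (5 / 3))
    (by linarith : 0 ≤ (5 - u) / (7 / 2)) (by linarith : 0 ≤ (u - 3 / 2) / (7 / 2)) (by ring)
  simp only [smul_eq_mul] at hconv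
  rw [show (5 - u) / (7 / 2) * (1 / 2) + (u - 3 / 2) / (7 / 2) * (5 / 3) = u / 3 by ring] at hconv
  have h3 : rexp (u / 3) ≤ 119 / 100 * u := by
    refine hconv.trans ?_
    calc _ ≤ (5 - u) / (7 / 2) * (119 / 100 * (3 / 2)) + (u - 3 / 2) / (7 / 2) * (119 / 100 * 5) :=
          add_le_add (mul_le_mul_of_nonneg_left ha (by linarith))
            (mul_le_mul_of_nonneg_left hb (by linarith))
      _ = _ := by ring
  have h4 : rexp u = rexp (u / 3) ^ 3 := by
    rw [← Real.exp_nat_mul]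
    congr 1
    push_cast
    ring
  calc rexp u * 192 ≤ (119 / 100 * u) ^ 3 * 192 := by
        rw [h4]
        gcongr
    _ ≤ _ := by nlinarith [pow_pos (by linarith : 0 < u) 3]

lemma exists_pow_le_exp_neg_mul {L : ℝ} (hL : 3 ≤ L) :
    ∃ k : ℕ, (192 * (k + 1 : ℝ) ^ 3) ^ (k + 1) ≤ rexp (-L) * (324 * L ^ 3) ^ (k + 1) := by
  refine ⟨⌊L / 5⌋₊, ?_⟩
  have h1 := Nat.floor_le (by positivity : 0 ≤ L / 5)
  have h2 := Nat.lt_floor_add_one (L / 5)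
  set k := ⌊L / 5⌋₊
  have hK : (0 : ℝ) < k + 1 := by positivity
  have h3 := exp_mul_le_cube (u := L / (k + 1)) (by rw [le_div_iff₀ hK]; linarith)
    (by rw [div_le_iff₀ hK]; linarith)
  have h4 : rexp (-L) = rexp (-(L / (k + 1))) ^ (k + 1) := by
    rw [← Real.exp_nat_mul]
    congr 1
    push_cast
    field_simp
  rw [h4, ← mul_pow]
  refine pow_le_pow_left₀ (by positivity) ?_ _
  rw [Real.exp_neg, inv_mul_eq_div, le_div_iff₀ (Real.exp_pos _)]
  rw [div_pow, ← mul_div_assoc, le_div_iff₀ (by positivity)] at h3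
  linarith

lemma three_le_log {ε : ℝ} (hε0 : 0 < ε) (hε1 : ε ≤ 1 / 2) : 3 ≤ Real.log (11 / ε) := by
  rw [Real.le_log_iff_exp_le (by positivity), le_div_iff₀ hε0]
  have h : rexp 3 = rexp 1 ^ 3 := by
    rw [← Real.exp_nat_mul]
    norm_num
  have h2 : rexp 3 ≤ 22 := by
    rw [h]
    calc _ ≤ (2.7182818286 : ℝ) ^ 3 := by
          gcongr
          exact Real.exp_one_lt_d9.le
      _ ≤ _ := by norm_num
  nlinarith

lemma le_sq_inv_sub_one {d : ℝ} (h : |d| ≤ 1 / 10) :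
    ((1 + d) ^ 2)⁻¹ * d ^ 2 - d ^ 2 ≤ -2 * d ^ 3 + 4 * d ^ 4 := by
  obtain ⟨h1, h2⟩ := abs_le.mp h
  have hpos : 0 < (1 + d) ^ 2 := by
    have : 0 < 1 + d := by linarith
    positivity
  have h3 : ((1 + d) ^ 2)⁻¹ ≤ 1 - 2 * d + 4 * d ^ 2 := by
    rw [inv_le_iff_one_le_mul₀ hpos]
    have h4 : (1 - 2 * d + 4 * d ^ 2) * (1 + d) ^ 2 - 1 = d ^ 2 * (1 + 6 * d + 4 * d ^ 2) := by ring
    have h5 : 0 ≤ d ^ 2 * (1 + 6 * d + 4 * d ^ 2) :=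
      mul_nonneg (sq_nonneg _) (by nlinarith [sq_nonneg d])
    linarith
  nlinarith [mul_le_mul_of_nonneg_right h3 (sq_nonneg d)]

lemma dotProduct_Hmat_mulVec {n m : ℕ} (a : Fin m → Fin n → ℝ) (b : Fin m → ℝ)
    (z u v : Fin n → ℝ) :
    u ⬝ᵥ (Hmat a b z).mulVec v
      = ∑ i, ((a i ⬝ᵥ z - b i) ^ 2)⁻¹ * ((a i ⬝ᵥ u) * (a i ⬝ᵥ v)) := by
  rw [Hmat, sum_mulVec, dotProduct_sum]
  refine Finset.sum_congr rfl fun i _ => ?_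
  rw [smul_mulVec, vecMulVec_mulVec, dotProduct_smul, smul_eq_mul, dotProduct_comm u]
  simp [smul_dotProduct, mul_comm]

lemma Hmat_isUnit_det {n m : ℕ} (a : Fin m → Fin n → ℝ) (b : Fin m → ℝ)
    (hbdd : Bornology.IsBounded {x : Fin n → ℝ | ∀ i, b i ≤ a i ⬝ᵥ x})
    (x : Fin n → ℝ) (hx : x ∈ intK a b) : IsUnit (Hmat a b x).det := by
  rw [← Matrix.isUnit_iff_isUnit_det, ← Matrix.mulVec_injective_iff_isUnit]
  refine (injective_iff_map_eq_zero (Hmat a b x).mulVecLin).2 fun v hv => ?_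
  rw [Matrix.mulVecLin_apply] at hv
  have h0 := dotProduct_Hmat_mulVec a b x v v
  rw [hv, dotProduct_zero, eq_comm, Finset.sum_eq_zero_iff_of_nonneg
    (fun i _ => mul_nonneg (by positivity) (mul_self_nonneg _))] at h0
  have hav : ∀ i, a i ⬝ᵥ v = 0 := fun i => by
    have := h0 i (Finset.mem_univ i)
    have hs : (a i ⬝ᵥ x - b i) ≠ 0 := (sub_pos.2 (hx i)).ne'
    simpa [hs] using this
  by_contra hne
  obtain ⟨R, hR⟩ := hbdd.exists_norm_le
  have hv0 : 0 < ‖v‖ := norm_pos_iff.2 hne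
  have hmem : x + ((‖x‖ + |R| + 1) / ‖v‖) • v ∈ {x : Fin n → ℝ | ∀ i, b i ≤ a i ⬝ᵥ x} := by
    intro i
    rw [dotProduct_add, dotProduct_smul, hav i, smul_zero, add_zero]
    exact (hx i).le
  have h1 := hR _ hmem
  have h2 := norm_sub_le (x + ((‖x‖ + |R| + 1) / ‖v‖) • v) x
  rw [add_sub_cancel_left, norm_smul, Real.norm_of_nonneg (by positivity),
    div_mul_cancel₀ _ hv0.ne'] at h2
  linarith [le_abs_self R]

/-- The whitened constraint normals `H(x)^(-1/2) aᵢ / (aᵢ ⬝ᵥ x - bᵢ)` form a Parseval frame. -/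
lemma parseval_whitened {n m : ℕ} (a : Fin m → Fin n → ℝ) (b : Fin m → ℝ)
    (hbdd : Bornology.IsBounded {x : Fin n → ℝ | ∀ i, b i ≤ a i ⬝ᵥ x})
    (x : Fin n → ℝ) (hx : x ∈ intK a b) (S : Matrix (Fin n) (Fin n) ℝ) (hS : S.PosSemidef)
    (hSsq : S * S = (Hmat a b x)⁻¹) (v : Fin n → ℝ) :
    ∑ i, (((a i ⬝ᵥ x - b i)⁻¹ • S.mulVec (a i)) ⬝ᵥ v) ^ 2 = v ⬝ᵥ v := by
  have hSt : Sᵀ = S := by simpa [IsHermitian] using hS.isHermitian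
  have h1 : S * (S * Hmat a b x) = 1 := by
    rw [← mul_assoc, hSsq, Matrix.nonsing_inv_mul _ (Hmat_isUnit_det a b hbdd x hx)]
  rw [mul_eq_one_comm] at h1
  have hsymm : ∀ u w : Fin n → ℝ, S.mulVec u ⬝ᵥ w = u ⬝ᵥ S.mulVec w := fun u w => by
    rw [dotProduct_mulVec, ← mulVec_transpose, hSt]
  have h2 := dotProduct_Hmat_mulVec a b x (S.mulVec v) (S.mulVec v)
  rw [hsymm, mulVec_mulVec, mulVec_mulVec, h1, one_mulVec] at h2
  rw [h2]
  refine Finset.sum_congr rfl fun i _ => ?_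
  rw [smul_dotProduct, hsymm, smul_eq_mul, mul_pow, inv_pow, pow_two (a i ⬝ᵥ _)]

lemma sum_sq_inv_sub_sum_le {m n : ℕ} (hn : 1 ≤ n) {ε r q : ℝ} (hε0 : 0 < ε) (hε1 : ε ≤ 1 / 2)
    (hr0 : 0 < r) (hq : 5 ≤ q) (hr : r * q ≤ ε / 20) (t : Fin m → ℝ)
    (h4 : ∑ i, t i ^ 4 ≤ 18 * n / ε) (h3 : |∑ i, t i ^ 3| ≤ 18 * q * √n) :
    ∑ i, (((1 + r / √n * t i) ^ 2)⁻¹ * (r / √n * t i) ^ 2 - (r / √n * t i) ^ 2)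
      ≤ 2 * ε * r ^ 2 / n := by
  have hn' : (1 : ℝ) ≤ n := by exact_mod_cast hn
  have hs1 : √(n : ℝ) ^ 2 = n := Real.sq_sqrt (by positivity)
  have hs0 : 0 < √(n : ℝ) := Real.sqrt_pos.2 (by linarith)
  have hrε : r ≤ ε / 100 := by nlinarith
  have hsq : (r / √n) ^ 2 = r ^ 2 / n := by rw [div_pow, hs1]
  have hfour : (r / √n) ^ 4 = (r ^ 2 / n) ^ 2 := by rw [← hsq]; ring
  have hsmall : (r / √n) ^ 4 * (18 * n / ε) ≤ (r ^ 2 / n) * (ε / 500) := by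
    rw [hfour]
    have : (r ^ 2 / n) ^ 2 * (18 * n / ε) = (r ^ 2 / n) * (18 * r ^ 2 / ε) := by
      field_simp
    rw [this]
    refine mul_le_mul_of_nonneg_left ?_ (by positivity)
    rw [div_le_iff₀ hε0]
    nlinarith
  have hd : ∀ i, |r / √n * t i| ≤ 1 / 10 := by
    intro i
    have h5 : t i ^ 4 ≤ 18 * n / ε := le_trans
      (Finset.single_le_sum (f := fun i => t i ^ 4) (fun j _ => by positivity)
        (Finset.mem_univ i)) h4
    refine le_of_pow_le_pow_left₀ (n := 4) (by norm_num) (by norm_num) ?_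
    rw [pow_abs, abs_of_nonneg (by positivity), mul_pow]
    have h6 : r ^ 2 / n ≤ 1 / 100 := by
      rw [div_le_iff₀ (by linarith)]
      nlinarith
    calc _ ≤ (r / √n) ^ 4 * (18 * n / ε) := by gcongr
      _ ≤ (r ^ 2 / n) * (ε / 500) := hsmall
      _ ≤ 1 / 100 * (1 / 500) := by gcongr; linarith
      _ ≤ _ := by norm_num
  have h7 : ∑ i, (((1 + r / √n * t i) ^ 2)⁻¹ * (r / √n * t i) ^ 2 - (r / √n * t i) ^ 2)
      ≤ -2 * (r / √n) ^ 3 * ∑ i, t i ^ 3 + 4 * ((r / √n) ^ 4 * ∑ i, t i ^ 4) := by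
    rw [Finset.mul_sum, Finset.mul_sum, Finset.mul_sum, ← Finset.sum_add_distrib]
    refine Finset.sum_le_sum fun i _ => (le_sq_inv_sub_one (hd i)).trans_eq ?_
    ring
  have h8 : -2 * (r / √n) ^ 3 * ∑ i, t i ^ 3 ≤ r ^ 2 / n * (9 / 5 * ε) := by
    calc _ = 2 * (r / √n) ^ 3 * -∑ i, t i ^ 3 := by ring
      _ ≤ 2 * (r / √n) ^ 3 * (18 * q * √n) := by
        refine mul_le_mul_of_nonneg_left ((neg_le_abs _).trans h3) (by positivity)
      _ = (r / √n) ^ 2 * (36 * (r * q)) := by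
        field_simp
        ring
      _ ≤ _ := by
        rw [hsq]
        refine mul_le_mul_of_nonneg_left ?_ (by positivity)
        linarith
  have h9 : (r / √n) ^ 4 * ∑ i, t i ^ 4 ≤ r ^ 2 / n * (ε / 500) :=
    (mul_le_mul_of_nonneg_left h4 (by positivity)).trans hsmall
  have h10 : 0 < r ^ 2 / n := by positivity
  have h11 : 2 * ε * r ^ 2 / n = r ^ 2 / n * (2 * ε) := by ring
  rw [h11]
  nlinarith

lemma stdGauss_real_quartic_le {m n : ℕ} {c : Fin m → Fin n → ℝ}
    (hc : ∀ v, ∑ i, (c i ⬝ᵥ v) ^ 2 = v ⬝ᵥ v) (hn : 1 ≤ n) {ε : ℝ} (hε0 : 0 < ε) :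
    (stdGauss n).real {g | 18 * n / ε ≤ ∑ i, (c i ⬝ᵥ g) ^ 4} ≤ ε / 2 := by
  have hn' : (0 : ℝ) < n := by exact_mod_cast hn
  have h := mul_meas_ge_le_integral_of_nonneg (μ := stdGauss n)
    (f := fun g => MvPolynomial.eval g (powerSum c 4))
    (Filter.Eventually.of_forall fun g => by
      simp only [eval_powerSum, Pi.zero_apply]
      positivity) (integrable_eval_stdGauss _) (18 * n / ε)
  rw [← gaussExp_apply] at h
  simp only [eval_powerSum] at h
  have h2 := gaussExp_powerSum_four_pow_le hc 0
  rw [zero_add, pow_one, mul_one, Nat.cast_zero, mul_zero, add_zero, mul_pow,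
    Real.sq_sqrt hn'.le] at h2
  have h3 := h.trans h2
  rw [div_mul_eq_mul_div, div_le_iff₀ hε0] at h3
  nlinarith

lemma stdGauss_real_cubic_le {m n : ℕ} {c : Fin m → Fin n → ℝ}
    (hc : ∀ v, ∑ i, (c i ⬝ᵥ v) ^ 2 = v ⬝ᵥ v) (hn : 1 ≤ n) {L : ℝ} (hL : 3 ≤ L) :
    (stdGauss n).real {g | 18 * √(L ^ 3) * √n ≤ |∑ i, (c i ⬝ᵥ g) ^ 3|} ≤ rexp (-L) := by
  have hn' : (0 : ℝ) < n := by exact_mod_cast hn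
  obtain ⟨k, hk⟩ := exists_pow_le_exp_neg_mul hL
  have h := mul_meas_ge_le_integral_of_nonneg (μ := stdGauss n)
    (f := fun g => MvPolynomial.eval g (powerSum c 3 ^ (2 * (k + 1))))
    (Filter.Eventually.of_forall fun g => by
      simp only [map_pow, Pi.zero_apply, pow_mul]
      positivity) (integrable_eval_stdGauss _) ((324 * L ^ 3 * n) ^ (k + 1))
  rw [← gaussExp_apply] at h
  have hT : (18 * √(L ^ 3) * √n) ^ (2 * (k + 1)) = (324 * L ^ 3 * n) ^ (k + 1) := by
    rw [pow_mul]
    congr 1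
    rw [mul_pow, mul_pow, Real.sq_sqrt (by positivity), Real.sq_sqrt hn'.le]
    norm_num
  have hsub : {g | 18 * √(L ^ 3) * √n ≤ |∑ i, (c i ⬝ᵥ g) ^ 3|}
      ⊆ {g | (324 * L ^ 3 * n) ^ (k + 1)
        ≤ MvPolynomial.eval g (powerSum c 3 ^ (2 * (k + 1)))} := by
    intro g hg
    simp only [Set.mem_ofPred_eq, map_pow, eval_powerSum] at hg ⊢
    rw [← hT, ← Even.pow_abs (even_two_mul (k + 1)) (∑ i, (c i ⬝ᵥ g) ^ 3)]
    gcongr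
  refine (measureReal_mono hsub).trans ?_
  have h2 := h.trans (gaussExp_powerSum_three_pow_le hc hn k)
  have h3 : (192 * (k + 1 : ℝ) ^ 3 * n) ^ (k + 1)
      ≤ (324 * L ^ 3 * n) ^ (k + 1) * rexp (-L) := by
    rw [mul_pow _ (n : ℝ), mul_pow _ (n : ℝ)]
    nlinarith [pow_pos hn' (k + 1)]
  exact le_of_mul_le_mul_left (h2.trans h3) (by positivity)

/-- With probability at least 1 − ε over z = x + (r/√n)·H(x)^(−1/2)·g, g ∼ N(0,Iₙ),
we have ‖z−x‖_z² − ‖z−x‖ₓ² ≤ 2ε·r²/n.  Here `S`, the inverse square root of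
`H(x)`, is characterized as the positive semidefinite matrix with S·S = H(x)⁻¹. -/
theorem local_norm_change_whp {n m : ℕ} (hn : 1 ≤ n)
    (a : Fin m → Fin n → ℝ) (b : Fin m → ℝ)
    (hbdd : Bornology.IsBounded {x : Fin n → ℝ | ∀ i, b i ≤ a i ⬝ᵥ x})
    (x : Fin n → ℝ) (hx : x ∈ intK a b)
    (ε : ℝ) (hε0 : 0 < ε) (hε1 : ε ≤ 1/2)
    (r : ℝ) (hr0 : 0 < r)
    (hr : r ≤ ε / 20 * (Real.log (11 / ε)) ^ (-(3 : ℝ) / 2))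
    (S : Matrix (Fin n) (Fin n) ℝ) (hS : S.PosSemidef)
    (hSsq : S * S = (Hmat a b x)⁻¹) :
    ENNReal.ofReal (1 - ε) ≤
      stdGauss n {g |
        (fun z => ((z - x) ⬝ᵥ (Hmat a b z).mulVec (z - x))
            - ((z - x) ⬝ᵥ (Hmat a b x).mulVec (z - x)))
          (x + (r / Real.sqrt n) • S.mulVec g) ≤ 2 * ε * r ^ 2 / n} := by
  set c : Fin m → Fin n → ℝ := fun i => (a i ⬝ᵥ x - b i)⁻¹ • S.mulVec (a i) with hcdef
  have hc : ∀ v, ∑ i, (c i ⬝ᵥ v) ^ 2 = v ⬝ᵥ v := parseval_whitened a b hbdd x hx S hS hSsq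
  set L := Real.log (11 / ε) with hLdef
  have hL : 3 ≤ L := three_le_log hε0 hε1
  have hexp : rexp (-L) = ε / 11 := by
    rw [Real.exp_neg, hLdef, Real.exp_log (by positivity), inv_div]
  have hq5 : 5 ≤ √(L ^ 3) := by
    refine Real.le_sqrt_of_sq_le ?_
    calc (5 : ℝ) ^ 2 ≤ 3 ^ 3 := by norm_num
      _ ≤ _ := by gcongr
  have hpow : L ^ (-(3 : ℝ) / 2) = (√(L ^ 3))⁻¹ := by
    rw [Real.sqrt_eq_rpow, ← Real.rpow_natCast, ← Real.rpow_mul (by linarith),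
      ← Real.rpow_neg (by linarith)]
    norm_num
  have hrq : r * √(L ^ 3) ≤ ε / 20 := by
    rwa [hpow, ← div_eq_mul_inv, le_div_iff₀ (by linarith)] at hr
  set B₁ := {g : Fin n → ℝ | 18 * n / ε ≤ ∑ i, (c i ⬝ᵥ g) ^ 4} with hB₁
  set B₂ := {g : Fin n → ℝ | 18 * √(L ^ 3) * √n ≤ |∑ i, (c i ⬝ᵥ g) ^ 3|} with hB₂
  have hcont : ∀ i, Continuous fun g : Fin n → ℝ => c i ⬝ᵥ g := fun i =>
    continuous_const.dotProduct continuous_id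
  have hmeas : MeasurableSet (B₁ ∪ B₂) :=
    (measurableSet_le measurable_const (by fun_prop)).union
      (measurableSet_le measurable_const (by fun_prop))
  have hbad : (stdGauss n).real (B₁ ∪ B₂) ≤ ε := by
    have h1 : (stdGauss n).real B₁ ≤ ε / 2 := stdGauss_real_quartic_le hc hn hε0
    have h2 : (stdGauss n).real B₂ ≤ rexp (-L) := stdGauss_real_cubic_le hc hn hL
    have h3 := measureReal_union_le (μ := stdGauss n) B₁ B₂
    linarith
  have hgood : ENNReal.ofReal (1 - ε) ≤ stdGauss n (B₁ ∪ B₂)ᶜ := by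
    rw [← ofReal_measureReal, probReal_compl_eq_one_sub hmeas]
    exact ENNReal.ofReal_le_ofReal (by linarith)
  refine hgood.trans (measure_mono fun g hg => ?_)
  simp only [Set.mem_compl_iff, Set.mem_union, not_or, hB₁, hB₂, Set.mem_ofPred_eq, not_le] at hg
  have hSt : Sᵀ = S := by simpa [IsHermitian] using hS.isHermitian
  have key := sum_sq_inv_sub_sum_le hn hε0 hε1 hr0 hq5 hrq (fun i => c i ⬝ᵥ g) hg.1.le hg.2.le
  simp only [Set.mem_ofPred_eq, add_sub_cancel_left, dotProduct_Hmat_mulVec]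
  rw [← Finset.sum_sub_distrib]
  refine (Finset.sum_le_sum fun i _ => le_of_eq ?_).trans key
  have hs : a i ⬝ᵥ x - b i ≠ 0 := (sub_pos.2 (hx i)).ne'
  have hct : a i ⬝ᵥ S.mulVec g = (a i ⬝ᵥ x - b i) * (c i ⬝ᵥ g) := by
    rw [hcdef, smul_dotProduct, smul_eq_mul, mul_inv_cancel_left₀ hs, dotProduct_mulVec,
      ← mulVec_transpose, hSt]
  rw [dotProduct_add, dotProduct_smul, smul_eq_mul, hct]
  set s := a i ⬝ᵥ x - b i
  rw [show a i ⬝ᵥ x + r / √n * (s * (c i ⬝ᵥ g)) - b i = s * (1 + r / √n * (c i ⬝ᵥ g)) by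
    simp only [s]
    ring]
  rw [mul_pow, mul_inv]
  field_simp
end

section
/- Let b₁, …, b_m ∈ ℝⁿ satisfy ∑_{i=1}^m bᵢbᵢᵀ = Iₙ, and let g ∼ N(0, Iₙ) be a standard Gaussian vector on ℝⁿ. Then E[ ( ∑_{i=1}^m (bᵢᵀg)⁴ )² ] ≤ 105n². -/
open Matrix MeasureTheory ProbabilityTheory

lemma iteratedDeriv_exp_sq (v : ℝ) (n : ℕ) (t : ℝ) :
    iteratedDeriv (n + 2) (fun t ↦ Real.exp (v * t ^ 2 / 2)) t =
      v * (t * iteratedDeriv (n + 1) (fun t ↦ Real.exp (v * t ^ 2 / 2)) t +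
        (n + 1) * iteratedDeriv n (fun t ↦ Real.exp (v * t ^ 2 / 2)) t) := by
  set f := fun t ↦ Real.exp (v * t ^ 2 / 2) with hf
  have hsmooth : ContDiff ℝ ⊤ f := by fun_prop
  have hderiv (k : ℕ) (t : ℝ) :
      HasDerivAt (iteratedDeriv k f) (iteratedDeriv (k + 1) f t) t := by
    rw [iteratedDeriv_succ]
    exact ((hsmooth.differentiable_iteratedDeriv k (by simp)) t).hasDerivAt
  induction n generalizing t with
  | zero =>
    have h1 : iteratedDeriv 1 f = fun t ↦ v * (t * f t) := by
      ext t
      rw [iteratedDeriv_one]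
      refine (((((hasDerivAt_id t).pow 2).const_mul v).div_const 2).exp).deriv.trans ?_
      simp [hf]; ring
    have h2 := (((hasDerivAt_id t).mul (hderiv 0 t)).const_mul v).deriv
    rw [iteratedDeriv_succ (n := 1), h1]
    simp only [iteratedDeriv_zero, zero_add, id, h1, one_mul] at h2 ⊢
    refine h2.trans ?_
    push_cast; ring
  | succ n ih =>
    rw [iteratedDeriv_succ (n := n + 2)]
    refine (congrArg (deriv · t) (funext ih)).trans ?_
    refine ((((hasDerivAt_id t).mul (hderiv (n + 1) t)).add
      ((hderiv n t).const_mul ((n : ℝ) + 1))).const_mul v).deriv.trans ?_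
    simp only [id, add_assoc, Nat.reduceAdd]
    push_cast; ring

lemma mgf_dotProduct_stdGauss {n : ℕ} (a : Fin n → ℝ) (t : ℝ) :
    mgf (fun g ↦ a ⬝ᵥ g) (stdGauss n) t = Real.exp ((a ⬝ᵥ a) * t ^ 2 / 2) := by
  simp only [mgf, dotProduct, stdGauss, Finset.mul_sum, Real.exp_sum]
  rw [integral_fintype_prod_eq_prod (f := fun i x ↦ Real.exp (t * (a i * x)))]
  have h (i : Fin n) : ∫ x, Real.exp (t * (a i * x)) ∂(gaussianReal 0 1) =
      Real.exp (a i * a i * t ^ 2 / 2) := by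
    have := congrFun (mgf_id_gaussianReal (μ := 0) (v := 1)) (t * a i)
    simp only [mgf, id, NNReal.coe_one, zero_mul, one_mul, zero_add, mul_assoc] at this
    rw [this]; congr 1; ring
  simp only [h, ← Real.exp_sum, Finset.sum_mul, Finset.sum_div]

lemma zero_mem_interior_integrableExpSet {n : ℕ} (a : Fin n → ℝ) :
    0 ∈ interior (integrableExpSet (fun g ↦ a ⬝ᵥ g) (stdGauss n)) := by
  suffices integrableExpSet (fun g ↦ a ⬝ᵥ g) (stdGauss n) = Set.univ by simp [this]
  refine Set.eq_univ_of_forall fun t ↦ ?_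
  by_contra h
  have h0 := mgf_undef h
  rw [mgf_dotProduct_stdGauss] at h0
  exact (Real.exp_pos _).ne' h0

lemma integrable_dotProduct_pow {n : ℕ} (a : Fin n → ℝ) (k : ℕ) :
    Integrable (fun g ↦ (a ⬝ᵥ g) ^ k) (stdGauss n) :=
  integrable_pow_of_mem_interior_integrableExpSet (zero_mem_interior_integrableExpSet a) k

lemma integral_dotProduct_pow_eight {n : ℕ} (a : Fin n → ℝ) :
    ∫ g, (a ⬝ᵥ g) ^ 8 ∂(stdGauss n) = 105 * (a ⬝ᵥ a) ^ 4 := by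
  have h := iteratedDeriv_mgf_zero (zero_mem_interior_integrableExpSet a) 8
  rw [show mgf (fun g ↦ a ⬝ᵥ g) (stdGauss n) = _ from funext (mgf_dotProduct_stdGauss a)] at h
  refine h.symm.trans ?_
  simp only [iteratedDeriv_exp_sq _ 6, iteratedDeriv_exp_sq _ 4, iteratedDeriv_exp_sq _ 2,
    iteratedDeriv_exp_sq _ 0, iteratedDeriv_zero, zero_mul, zero_add]
  norm_num
  ring

theorem second_moment_sum_fourth_powers_le {n m : ℕ} (b : Fin m → Fin n → ℝ)
    (hb : ∑ i, vecMulVec (b i) (b i) = (1 : Matrix (Fin n) (Fin n) ℝ)) :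
    ∫ g, (∑ i, (b i ⬝ᵥ g) ^ 4) ^ 2 ∂(stdGauss n) ≤ 105 * (n : ℝ) ^ 2 := by
  set s : Fin m → ℝ := fun i ↦ b i ⬝ᵥ b i with hs
  have hs0 (i) : 0 ≤ s i := Finset.sum_nonneg fun j _ ↦ mul_self_nonneg _
  have hsum : ∑ i, s i = n := by
    have := congrArg trace hb
    simpa [trace_sum, trace_vecMulVec] using this
  have hs1 (i) : s i ≤ 1 := by
    have h : s i = ∑ j, (b j ⬝ᵥ b i) ^ 2 := by
      have := congrArg (fun M ↦ b i ⬝ᵥ M *ᵥ b i) hb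
      simp only [sum_mulVec, vecMulVec_mulVec, dotProduct_sum, one_mulVec] at this
      rw [hs]
      simp only
      rw [← this]
      refine Finset.sum_congr rfl fun j _ ↦ ?_
      simp [dotProduct_comm (b i) (b j)]; ring
    have h2 : s i ^ 2 ≤ s i := by
      conv_rhs => rw [h]
      exact Finset.single_le_sum (f := fun j ↦ (b j ⬝ᵥ b i) ^ 2) (fun j _ ↦ sq_nonneg _)
        (Finset.mem_univ i)
    nlinarith [hs0 i]
  have hpt (g : Fin n → ℝ) :
      (∑ i, (b i ⬝ᵥ g) ^ 4) ^ 2 ≤ n * ∑ i, (b i ⬝ᵥ g) ^ 8 / s i := by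
    rw [← hsum]
    refine Finset.sum_sq_le_sum_mul_sum_of_sq_le_mul _ (fun i _ ↦ hs0 i)
      (fun i _ ↦ div_nonneg (by positivity) (hs0 i)) fun i _ ↦ ?_
    rcases eq_or_ne (s i) 0 with h | h
    · have : b i = 0 := dotProduct_self_eq_zero.1 h
      simp [this]
    · exact le_of_eq (by field_simp)
  have hint (i) : Integrable (fun g ↦ (b i ⬝ᵥ g) ^ 8 / s i) (stdGauss n) :=
    (integrable_dotProduct_pow (b i) 8).div_const _
  calc ∫ g, (∑ i, (b i ⬝ᵥ g) ^ 4) ^ 2 ∂(stdGauss n)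
      ≤ ∫ g, n * ∑ i, (b i ⬝ᵥ g) ^ 8 / s i ∂(stdGauss n) :=
        integral_mono_of_nonneg (.of_forall fun g ↦ sq_nonneg _)
          ((integrable_finsetSum _ fun i _ ↦ hint i).const_mul _) (.of_forall hpt)
    _ = n * ∑ i, 105 * s i ^ 4 / s i := by
        rw [integral_const_mul, integral_finsetSum _ fun i _ ↦ hint i]
        simp only [integral_div, integral_dotProduct_pow_eight, hs]
    _ ≤ n * ∑ i, 105 * s i := by
        gcongr with i
        refine div_le_of_le_mul₀ (hs0 i) (by linarith [hs0 i]) ?_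
        nlinarith [pow_le_of_le_one (hs0 i) (hs1 i) two_ne_zero, hs0 i, hs1 i,
          pow_le_pow_of_le_one (hs0 i) (hs1 i) (show 2 ≤ 4 by norm_num)]
    _ = 105 * (n : ℝ) ^ 2 := by rw [← Finset.mul_sum, hsum]; ring
end
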